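/- Let F = (X_n, K_n, π_n)_{n≥1} be a family of irreducible birth and death chains on X_n = {0,1,...,n} and let F_c be the family of associated continuous-time chains. Let λ_n be the smallest non-zero eigenvalue of I − K_n. For each n choose M_n ∈ X_n with inf_n π_n([0,M_n]) > 0 and inf_n π_n([M_n,n]) > 0, and set θ_n = max{E_0 τ̃^{(n)}_{M_n}, E_n τ̃^{(n)}_{M_n}} and α_n² = max{Var_0 τ̃^{(n)}_{M_n}, Var_n τ̃^{(n)}_{M_n}}. Then F_c has a maximum total variation cutoff if and only if θ_n λ_n → ∞, if and only if θ_n/α_n → ∞; furthermore, if F_c has a cutoff, then it has a (θ_n, α_n) maximum total variation cutoff. -/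

import Mathlib

open scoped BigOperators
open Filter Matrix Polynomial MeasureTheory

noncomputable section

/-- An irreducible birth and death chain on `{0,1,...,n}`, together with its
(unique) stationary distribution. -/
structure BDChain (n : ℕ) where
  K : Matrix (Fin (n + 1)) (Fin (n + 1)) ℝ
  pi : Fin (n + 1) → ℝ
  K_nonneg : ∀ i j, 0 ≤ K i j
  K_rowSum : ∀ i, ∑ j, K i j = 1
  K_tridiag : ∀ i j : Fin (n + 1), 1 < |(i : ℤ) - (j : ℤ)| → K i j = 0
  K_irred : ∀ i : ℕ, ∀ h : i < n,
    0 < K ⟨i, by omega⟩ ⟨i + 1, by omega⟩ ∧ 0 < K ⟨i + 1, by omega⟩ ⟨i, by omega⟩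
  pi_pos : ∀ i, 0 < pi i
  pi_sum : ∑ i, pi i = 1
  pi_stat : ∀ j, ∑ i, pi i * K i j = pi j

namespace BDChain

variable {n : ℕ}

/-- `π([0,M])` -/
def piLow (c : BDChain n) (M : Fin (n + 1)) : ℝ :=
  ∑ ℓ : Fin (n + 1), if ℓ ≤ M then c.pi ℓ else 0

/-- `π([M,n])` -/
def piHigh (c : BDChain n) (M : Fin (n + 1)) : ℝ :=
  ∑ ℓ : Fin (n + 1), if M ≤ ℓ then c.pi ℓ else 0

/-- `π([a,b])` -/
def piInt (c : BDChain n) (a b : Fin (n + 1)) : ℝ :=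
  ∑ ℓ : Fin (n + 1), if a ≤ ℓ ∧ ℓ ≤ b then c.pi ℓ else 0

/-- The substochastic matrix of the chain killed at state `i`. -/
def killed (c : BDChain n) (i : Fin (n + 1)) : Matrix (Fin (n + 1)) (Fin (n + 1)) ℝ :=
  Matrix.of fun x y => if x = i ∨ y = i then 0 else c.K x y

/-- `P_j(τ_i > m)`, where `τ_i` is the discrete-time hitting time of state `i`. -/
def hitSurv (c : BDChain n) (i j : Fin (n + 1)) (m : ℕ) : ℝ :=
  if j = i then 0 else ∑ y, (c.killed i ^ m) j y

/-- `P_j(τ̃_i > t)`, where `τ̃_i` is the continuous-time hitting time of state `i`. -/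
def hitSurvC (c : BDChain n) (i j : Fin (n + 1)) (t : ℝ) : ℝ :=
  ∑' m : ℕ, (Real.exp (-t) * t ^ m / m.factorial) * c.hitSurv i j m

/-- `E_j τ_i` -/
def hitMean (c : BDChain n) (i j : Fin (n + 1)) : ℝ :=
  ∑' m : ℕ, c.hitSurv i j m

/-- `Var_j τ_i` -/
def hitVar (c : BDChain n) (i j : Fin (n + 1)) : ℝ :=
  (∑' m : ℕ, (2 * (m : ℝ) + 1) * c.hitSurv i j m) - (c.hitMean i j) ^ 2

/-- `E_j τ̃_i` -/
def hitMeanC (c : BDChain n) (i j : Fin (n + 1)) : ℝ :=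
  ∫ t in Set.Ioi (0 : ℝ), c.hitSurvC i j t

/-- `Var_j τ̃_i` -/
def hitVarC (c : BDChain n) (i j : Fin (n + 1)) : ℝ :=
  (∫ t in Set.Ioi (0 : ℝ), 2 * t * c.hitSurvC i j t) - (c.hitMeanC i j) ^ 2

/-- The substochastic matrix of the chain killed at states `i` and `k`. -/
def killed2 (c : BDChain n) (i k : Fin (n + 1)) : Matrix (Fin (n + 1)) (Fin (n + 1)) ℝ :=
  Matrix.of fun x y => if x = i ∨ x = k ∨ y = i ∨ y = k then 0 else c.K x y

/-- `P_j(min{τ_i, τ_k} > m)` -/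
def hitSurv2 (c : BDChain n) (i k j : Fin (n + 1)) (m : ℕ) : ℝ :=
  if j = i ∨ j = k then 0 else ∑ y, (c.killed2 i k ^ m) j y

/-- `E_j min{τ_i, τ_k}` -/
def hitMean2 (c : BDChain n) (i k j : Fin (n + 1)) : ℝ :=
  ∑' m : ℕ, c.hitSurv2 i k j m

/-- `E_j min{τ̃_i, τ̃_k}` -/
def hitMean2C (c : BDChain n) (i k j : Fin (n + 1)) : ℝ :=
  ∫ t in Set.Ioi (0 : ℝ),
    ∑' m : ℕ, (Real.exp (-t) * t ^ m / m.factorial) * c.hitSurv2 i k j m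

/-- The continuous-time kernel `H_t(x,y) = e^{-t(I-K)}(x,y)`. -/
def Ht (c : BDChain n) (t : ℝ) (x y : Fin (n + 1)) : ℝ :=
  ∑' m : ℕ, (Real.exp (-t) * t ^ m / m.factorial) * (c.K ^ m) x y

/-- Discrete-time total variation distance from starting state `x` at time `m`. -/
def dTV (c : BDChain n) (x : Fin (n + 1)) (m : ℕ) : ℝ :=
  ⨆ A : Finset (Fin (n + 1)), (∑ y ∈ A, (c.K ^ m) x y - ∑ y ∈ A, c.pi y)

/-- Continuous-time total variation distance from starting state `x` at time `t`. -/
def dTVC (c : BDChain n) (x : Fin (n + 1)) (t : ℝ) : ℝ :=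
  ⨆ A : Finset (Fin (n + 1)), (∑ y ∈ A, c.Ht t x y - ∑ y ∈ A, c.pi y)

/-- Maximum (over starting states) discrete-time total variation distance. -/
def dTVMax (c : BDChain n) (m : ℕ) : ℝ := ⨆ x, c.dTV x m

/-- Maximum (over starting states) continuous-time total variation distance. -/
def dTVMaxC (c : BDChain n) (t : ℝ) : ℝ := ⨆ x, c.dTVC x t

/-- Discrete-time separation from starting state `x` at time `m`. -/
def sep (c : BDChain n) (x : Fin (n + 1)) (m : ℕ) : ℝ :=
  ⨆ y, (1 - (c.K ^ m) x y / c.pi y)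

/-- Continuous-time separation from starting state `x` at time `t`. -/
def sepC (c : BDChain n) (x : Fin (n + 1)) (t : ℝ) : ℝ :=
  ⨆ y, (1 - c.Ht t x y / c.pi y)

end BDChain

/-- Discrete-time `ε`-mixing time for a distance profile `d`. -/
def mixD (d : ℕ → ℝ) (ε : ℝ) : ℕ := sInf {m : ℕ | d m ≤ ε}

/-- Continuous-time `ε`-mixing time for a distance profile `d`. -/
def mixC (d : ℝ → ℝ) (ε : ℝ) : ℝ := sInf {t : ℝ | 0 ≤ t ∧ d t ≤ ε}

/-- The set of (real) eigenvalues of a square matrix. -/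
def eigSet {ι : Type*} [Fintype ι] (M : Matrix ι ι ℝ) : Set ℝ :=
  {x | ∃ v : ι → ℝ, v ≠ 0 ∧ M.mulVec v = x • v}

/-- `l` is the smallest non-zero eigenvalue of `M`. -/
def IsSmallestNonzeroEig {ι : Type*} [Fintype ι] (M : Matrix ι ι ℝ) (l : ℝ) : Prop :=
  l ∈ eigSet M ∧ l ≠ 0 ∧ ∀ x ∈ eigSet M, x ≠ 0 → l ≤ x

/-- `l` is the smallest eigenvalue of `M`. -/
def IsSmallestEig {ι : Type*} [Fintype ι] (M : Matrix ι ι ℝ) (l : ℝ) : Prop :=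
  l ∈ eigSet M ∧ ∀ x ∈ eigSet M, l ≤ x

/-- The principal submatrix of `I - K` indexed by the states `0, 1, ..., M-1`. -/
def BDChain.subIK {n : ℕ} (c : BDChain n) (M : Fin (n + 1)) :
    Matrix (Fin (M : ℕ)) (Fin (M : ℕ)) ℝ :=
  Matrix.of fun a b =>
    (1 - c.K) (Fin.castLE M.isLt.le a) (Fin.castLE M.isLt.le b)

/-- A family of chains, with `ε ↦ n ↦ T ε n` the mixing time profile, presents a cutoff
with cutoff time `t`. -/
def cutoffWith (T : ℝ → ℕ → ℝ) (t : ℕ → ℝ) : Prop :=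
  ∀ ε ∈ Set.Ioo (0 : ℝ) 1, Filter.Tendsto (fun n => T ε n / t n) Filter.atTop (nhds 1)

/-- A family of chains presents a cutoff. -/
def hasCutoff (T : ℝ → ℕ → ℝ) : Prop :=
  ∃ t : ℕ → ℝ, (∀ n, 0 < t n) ∧ cutoffWith T t

/-- A family of chains presents a `(t_n, b_n)` cutoff. -/
def cutoffWindow (T : ℝ → ℕ → ℝ) (t b : ℕ → ℝ) : Prop :=
  (∀ᶠ n in Filter.atTop, 0 < t n) ∧ (∀ᶠ n in Filter.atTop, 0 < b n) ∧
  Filter.Tendsto (fun n => b n / t n) Filter.atTop (nhds 0) ∧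
  ∀ ε ∈ Set.Ioo (0 : ℝ) 1, ∃ C : ℝ, ∀ᶠ n in Filter.atTop, |T ε n - t n| ≤ C * b n


namespace BDChain

variable {n : ℕ} (c : BDChain n)

/-- The transition matrix, indexed by natural numbers and extended by zero. -/
def ker (i j : ℕ) : ℝ :=
  if h : i < n + 1 ∧ j < n + 1 then c.K ⟨i, h.1⟩ ⟨j, h.2⟩ else 0

/-- The stationary distribution, indexed by natural numbers and extended by zero. -/
def wt (i : ℕ) : ℝ := if h : i < n + 1 then c.pi ⟨i, h⟩ else 0

/-- The conductance of the edge `{k, k+1}`. -/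
def conductance (k : ℕ) : ℝ := c.wt k * c.ker k (k + 1)

/-- The stationary mass of `[0, z]`. -/
def cum (z : ℕ) : ℝ := ∑ y ∈ Finset.range (z + 1), c.wt y

/-- The transition operator acting on functions of a natural number. -/
def avg (f : ℕ → ℝ) (i : ℕ) : ℝ := ∑ j ∈ Finset.range (n + 1), c.ker i j * f j

lemma ker_val (i j : Fin (n + 1)) : c.ker i j = c.K i j := by
  simp only [ker, i.isLt, j.isLt, and_self, dif_pos]

lemma wt_val (i : Fin (n + 1)) : c.wt i = c.pi i := by
  simp only [wt, i.isLt, dif_pos]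

lemma wt_pos {i : ℕ} (h : i < n + 1) : 0 < c.wt i := by
  simp only [wt, h, dif_pos]; exact c.pi_pos _

lemma wt_nonneg (i : ℕ) : 0 ≤ c.wt i := by
  unfold wt; split_ifs with h
  · exact (c.pi_pos _).le
  · exact le_rfl

lemma wt_of_gt {i : ℕ} (h : n < i) : c.wt i = 0 := by
  simp [wt, show ¬ i < n + 1 by omega]

lemma ker_nonneg (i j : ℕ) : 0 ≤ c.ker i j := by
  unfold ker; split_ifs
  · exact c.K_nonneg _ _
  · exact le_rfl

lemma ker_of_gt_left {i : ℕ} (h : n < i) (j : ℕ) : c.ker i j = 0 := by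
  simp [ker, show ¬ i < n + 1 by omega]

lemma ker_of_gt_right {j : ℕ} (h : n < j) (i : ℕ) : c.ker i j = 0 := by
  simp [ker, show ¬ j < n + 1 by omega]

lemma ker_far {i j : ℕ} (h : i + 1 < j ∨ j + 1 < i) : c.ker i j = 0 := by
  unfold ker; split_ifs with h'
  · apply c.K_tridiag
    simp only
    rw [lt_abs]; omega
  · rfl

lemma ker_succ_pos {k : ℕ} (h : k < n) : 0 < c.ker k (k + 1) := by
  simp only [ker, show k < n + 1 ∧ k + 1 < n + 1 by omega, and_self, dif_pos]
  exact (c.K_irred k h).1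

lemma conductance_pos {k : ℕ} (h : k < n) : 0 < c.conductance k :=
  mul_pos (c.wt_pos (by omega)) (c.ker_succ_pos h)

lemma conductance_of_ge {k : ℕ} (h : n ≤ k) : c.conductance k = 0 := by
  simp [conductance, c.ker_of_gt_right (show n < k + 1 by omega)]

lemma conductance_nonneg (k : ℕ) : 0 ≤ c.conductance k :=
  mul_nonneg (c.wt_nonneg _) (c.ker_nonneg _ _)

lemma avg_zero (f : ℕ → ℝ) : c.avg f 0 = c.ker 0 0 * f 0 + c.ker 0 1 * f 1 := by
  rw [avg, Finset.sum_congr_of_eq_on_inter (s₂ := ({0, 1} : Finset ℕ))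
    (g := fun j => c.ker 0 j * f j), Finset.sum_pair (by simp)]
  · intro j _ hj
    rw [c.ker_far (by simp at hj; omega), zero_mul]
  · intro j _ hj
    rw [c.ker_of_gt_right (by simp at hj; omega), zero_mul]
  · intros; rfl

lemma avg_succ (f : ℕ → ℝ) (k : ℕ) : c.avg f (k + 1) =
    c.ker (k + 1) k * f k + c.ker (k + 1) (k + 1) * f (k + 1)
      + c.ker (k + 1) (k + 2) * f (k + 2) := by
  rw [avg, Finset.sum_congr_of_eq_on_inter (s₂ := ({k, k + 1, k + 2} : Finset ℕ))
    (g := fun j => c.ker (k + 1) j * f j), Finset.sum_insert (by simp), Finset.sum_pair (by simp)]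
  · ring
  · intro j _ hj
    rw [c.ker_far (by simp at hj; omega), zero_mul]
  · intro j _ hj
    rw [c.ker_of_gt_right (by simp at hj; omega), zero_mul]
  · intros; rfl

lemma sum_fin_eq_range (F : ℕ → ℝ) :
    ∑ j : Fin (n + 1), F j = ∑ j ∈ Finset.range (n + 1), F j :=
  Fin.sum_univ_eq_sum_range F (n + 1)

lemma sum_K_eq_avg (f : ℕ → ℝ) (i : Fin (n + 1)) : ∑ j, c.K i j * f j = c.avg f i := by
  rw [avg, ← sum_fin_eq_range]
  exact Finset.sum_congr rfl fun j _ => by rw [ker_val]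

lemma avg_const {i : ℕ} (hi : i < n + 1) (a : ℝ) : c.avg (fun _ => a) i = a := by
  have := c.sum_K_eq_avg (fun _ => a) ⟨i, hi⟩
  rw [← Finset.sum_mul, c.K_rowSum, one_mul] at this
  exact this.symm

lemma sum_wt : ∑ i ∈ Finset.range (n + 1), c.wt i = 1 := by
  rw [← sum_fin_eq_range, ← c.pi_sum]
  exact Finset.sum_congr rfl fun j _ => c.wt_val j

lemma stationary (j : ℕ) : ∑ i ∈ Finset.range (n + 1), c.wt i * c.ker i j = c.wt j := by
  by_cases hj : j < n + 1
  · have := c.pi_stat ⟨j, hj⟩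
    rw [← c.wt_val] at this
    rw [← this, ← sum_fin_eq_range]
    exact Finset.sum_congr rfl fun i _ => by rw [← c.wt_val, ← c.ker_val]
  · rw [c.wt_of_gt (by omega)]
    exact Finset.sum_eq_zero fun i _ => by rw [c.ker_of_gt_right (by omega), mul_zero]

lemma stationary_zero : c.wt 0 * c.ker 0 0 + c.wt 1 * c.ker 1 0 = c.wt 0 := by
  conv_rhs => rw [← c.stationary 0]
  rw [Finset.sum_congr_of_eq_on_inter (s₂ := ({0, 1} : Finset ℕ))
    (g := fun i => c.wt i * c.ker i 0), Finset.sum_pair (by simp)]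
  · intro j _ hj
    rw [c.ker_far (by simp at hj; omega), mul_zero]
  · intro j _ hj
    rw [c.wt_of_gt (by simp at hj; omega), zero_mul]
  · intros; rfl

lemma stationary_succ (k : ℕ) : c.wt k * c.ker k (k + 1) + c.wt (k + 1) * c.ker (k + 1) (k + 1)
    + c.wt (k + 2) * c.ker (k + 2) (k + 1) = c.wt (k + 1) := by
  conv_rhs => rw [← c.stationary (k + 1)]
  rw [Finset.sum_congr_of_eq_on_inter (s₂ := ({k, k + 1, k + 2} : Finset ℕ))
    (g := fun i => c.wt i * c.ker i (k + 1)), Finset.sum_insert (by simp),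
    Finset.sum_pair (by simp)]
  · ring
  · intro j _ hj
    rw [c.ker_far (by simp at hj; omega), mul_zero]
  · intro j _ hj
    rw [c.wt_of_gt (by simp at hj; omega), zero_mul]
  · intros; rfl

lemma row_zero : c.ker 0 0 + c.ker 0 1 = 1 := by
  have := c.avg_const (i := 0) (by omega) 1
  rw [avg_zero] at this
  linarith

lemma row_succ {k : ℕ} (h : k < n) :
    c.ker (k + 1) k + c.ker (k + 1) (k + 1) + c.ker (k + 1) (k + 2) = 1 := by
  have := c.avg_const (i := k + 1) (by omega) 1
  rw [avg_succ] at this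
  linarith

/-- Detailed balance. -/
lemma conductance_eq (k : ℕ) : c.conductance k = c.wt (k + 1) * c.ker (k + 1) k := by
  induction k with
  | zero =>
    have h1 := c.stationary_zero
    have h2 := c.row_zero
    unfold conductance
    simp only [zero_add]
    linear_combination c.wt 0 * h2 - h1
  | succ k ih =>
    by_cases h : k < n
    · have h1 := c.stationary_succ k
      have h2 := c.row_succ h
      unfold conductance at ih ⊢
      linear_combination c.wt (k + 1) * h2 - h1 + ih
    · rw [c.conductance_of_ge (by omega), c.wt_of_gt (by omega), zero_mul]

lemma ker_reversible (i j : ℕ) : c.wt i * c.ker i j = c.wt j * c.ker j i := by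
  rcases lt_trichotomy i j with h | rfl | h
  · by_cases h' : j = i + 1
    · subst h'; exact c.conductance_eq i
    · rw [c.ker_far (by omega), c.ker_far (by omega), mul_zero, mul_zero]
  · rfl
  · by_cases h' : i = j + 1
    · subst h'; exact (c.conductance_eq j).symm
    · rw [c.ker_far (by omega), c.ker_far (by omega), mul_zero, mul_zero]

lemma wt_mul_gen_zero (f : ℕ → ℝ) :
    c.wt 0 * (f 0 - c.avg f 0) = c.conductance 0 * (f 0 - f 1) := by
  have h2 := c.row_zero
  rw [avg_zero, conductance]
  simp only [zero_add]
  linear_combination - c.wt 0 * f 0 * h2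

lemma wt_mul_gen_succ (f : ℕ → ℝ) (k : ℕ) :
    c.wt (k + 1) * (f (k + 1) - c.avg f (k + 1)) =
      c.conductance (k + 1) * (f (k + 1) - f (k + 2)) - c.conductance k * (f k - f (k + 1)) := by
  by_cases h : k < n
  · have h2 := c.row_succ h
    have h3 := c.conductance_eq k
    rw [avg_succ, h3, conductance]
    linear_combination - c.wt (k + 1) * f (k + 1) * h2
  · rw [c.conductance_of_ge (by omega), c.conductance_of_ge (by omega), c.wt_of_gt (by omega)]
    ring

/-- The net flow of the generator out of `[0, x]`. -/
lemma sum_wt_mul_gen (f : ℕ → ℝ) (x : ℕ) :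
    ∑ y ∈ Finset.range (x + 1), c.wt y * (f y - c.avg f y) =
      c.conductance x * (f x - f (x + 1)) := by
  induction x with
  | zero => simp [c.wt_mul_gen_zero f]
  | succ x ih => rw [Finset.sum_range_succ, ih, wt_mul_gen_succ]; ring

lemma dirichlet_aux (f : ℕ → ℝ) (x : ℕ) :
    ∑ y ∈ Finset.range (x + 1), c.wt y * (f y * (f y - c.avg f y)) =
      ∑ k ∈ Finset.range x, c.conductance k * (f k - f (k + 1)) ^ 2
        + f x * (c.conductance x * (f x - f (x + 1))) := by
  induction x with
  | zero => simp [← c.wt_mul_gen_zero f]; ring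
  | succ x ih =>
    rw [Finset.sum_range_succ, ih, Finset.sum_range_succ]
    linear_combination f (x + 1) * c.wt_mul_gen_succ f x

/-- The Dirichlet form. -/
lemma dirichlet (f : ℕ → ℝ) :
    ∑ y ∈ Finset.range (n + 1), c.wt y * (f y * (f y - c.avg f y)) =
      ∑ k ∈ Finset.range n, c.conductance k * (f k - f (k + 1)) ^ 2 := by
  rw [dirichlet_aux, c.conductance_of_ge le_rfl]; ring

lemma sum_wt_avg (f : ℕ → ℝ) :
    ∑ y ∈ Finset.range (n + 1), c.wt y * c.avg f y = ∑ y ∈ Finset.range (n + 1), c.wt y * f y := by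
  have := c.sum_wt_mul_gen f n
  rw [c.conductance_of_ge le_rfl, zero_mul] at this
  simp only [mul_sub, Finset.sum_sub_distrib] at this
  linarith

lemma cum_succ (z : ℕ) : c.cum (z + 1) = c.cum z + c.wt (z + 1) := by
  rw [cum, Finset.sum_range_succ]; rfl

lemma cum_mono : Monotone c.cum :=
  monotone_nat_of_le_succ fun z => by rw [cum_succ]; linarith [c.wt_nonneg (z + 1)]

lemma cum_pos (z : ℕ) : 0 < c.cum z := by
  refine lt_of_lt_of_le ?_ (c.cum_mono (Nat.zero_le z))
  simpa [cum] using c.wt_pos (i := 0) (by omega)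

lemma cum_top : c.cum n = 1 := c.sum_wt

lemma cum_lt_one {z : ℕ} (h : z < n) : c.cum z < 1 := by
  have h1 := c.cum_succ z
  have h2 := c.cum_mono (show z + 1 ≤ n from h)
  rw [cum_top] at h2
  linarith [c.wt_pos (show z + 1 < n + 1 by omega)]

end BDChain

namespace BDChain

variable {n : ℕ} (c : BDChain n)

lemma one_sub_K_mulVec (f : ℕ → ℝ) (i : Fin (n + 1)) :
    ((1 - c.K) *ᵥ fun j : Fin (n + 1) => f j) i = f i - c.avg f i := by
  rw [Matrix.sub_mulVec, Matrix.one_mulVec, Pi.sub_apply, ← c.sum_K_eq_avg]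
  rfl

/-- Extension by zero of a function on the state space. -/
def extend (v : Fin (n + 1) → ℝ) (k : ℕ) : ℝ := if h : k < n + 1 then v ⟨k, h⟩ else 0

lemma extend_val (v : Fin (n + 1) → ℝ) : (fun j : Fin (n + 1) => extend v j) = v := by
  ext j; simp only [extend, j.isLt, dif_pos]

lemma eigenfunction_extend {v : Fin (n + 1) → ℝ} {μ : ℝ} (h : (1 - c.K) *ᵥ v = μ • v)
    {i : ℕ} (hi : i < n + 1) : extend v i - c.avg (extend v) i = μ * extend v i := by
  have := c.one_sub_K_mulVec (extend v) ⟨i, hi⟩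
  rw [extend_val, h] at this
  rw [← this]
  simp [extend, hi]

lemma eigenfunction_energy {φ : ℕ → ℝ} {μ : ℝ}
    (h : ∀ i < n + 1, φ i - c.avg φ i = μ * φ i) :
    ∑ k ∈ Finset.range n, c.conductance k * (φ k - φ (k + 1)) ^ 2 =
      μ * ∑ i ∈ Finset.range (n + 1), c.wt i * φ i ^ 2 := by
  rw [← c.dirichlet, Finset.mul_sum]
  refine Finset.sum_congr rfl fun i hi => ?_
  rw [h i (Finset.mem_range.1 hi)]; ring

lemma eigenfunction_mean {φ : ℕ → ℝ} {μ : ℝ} (hμ : μ ≠ 0)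
    (h : ∀ i < n + 1, φ i - c.avg φ i = μ * φ i) :
    ∑ i ∈ Finset.range (n + 1), c.wt i * φ i = 0 := by
  have h1 := c.sum_wt_avg φ
  have h2 : ∑ i ∈ Finset.range (n + 1), c.wt i * (φ i - c.avg φ i) =
      μ * ∑ i ∈ Finset.range (n + 1), c.wt i * φ i := by
    rw [Finset.mul_sum]
    refine Finset.sum_congr rfl fun i hi => ?_
    rw [h i (Finset.mem_range.1 hi)]; ring
  simp only [mul_sub, Finset.sum_sub_distrib, h1, sub_self] at h2
  simpa [hμ] using h2.symm

lemma eq_of_energy_eq_zero {φ : ℕ → ℝ}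
    (h : ∑ k ∈ Finset.range n, c.conductance k * (φ k - φ (k + 1)) ^ 2 = 0) :
    ∀ i < n + 1, φ i = φ 0 := by
  intro i
  induction i with
  | zero => intro; rfl
  | succ i ih =>
    intro hi
    have h1 := (Finset.sum_eq_zero_iff_of_nonneg fun k _ =>
      mul_nonneg (c.conductance_nonneg k) (sq_nonneg _)).1 h i (Finset.mem_range.2 (by omega))
    have h2 := (c.conductance_pos (show i < n by omega)).ne'
    have h3 : φ i - φ (i + 1) = 0 := by simpa [h2] using h1
    linarith [ih (by omega)]

variable {c} {l : ℝ}

lemma exists_eigenfunction (hl : IsSmallestNonzeroEig (1 - c.K) l) :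
    ∃ φ : ℕ → ℝ, (∃ i < n + 1, φ i ≠ 0) ∧ (∀ i < n + 1, φ i - c.avg φ i = l * φ i) ∧
      ∑ i ∈ Finset.range (n + 1), c.wt i * φ i = 0 := by
  obtain ⟨⟨v, hv, hKv⟩, hl0, -⟩ := hl
  have h := fun i (hi : i < n + 1) => c.eigenfunction_extend hKv hi
  refine ⟨extend v, ?_, h, c.eigenfunction_mean hl0 h⟩
  obtain ⟨i, hi⟩ := Function.ne_iff.1 hv
  exact ⟨i, i.isLt, by simp only [extend, i.isLt, dif_pos]; exact hi⟩

lemma sum_wt_sq_pos {φ : ℕ → ℝ} (h : ∃ i < n + 1, φ i ≠ 0) :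
    0 < ∑ i ∈ Finset.range (n + 1), c.wt i * φ i ^ 2 := by
  obtain ⟨i, hi, h⟩ := h
  refine Finset.sum_pos' (fun k _ => mul_nonneg (c.wt_nonneg k) (sq_nonneg _))
    ⟨i, Finset.mem_range.2 hi, mul_pos (c.wt_pos hi) (by positivity)⟩

lemma gap_pos (hl : IsSmallestNonzeroEig (1 - c.K) l) : 0 < l := by
  obtain ⟨φ, hφ, h, -⟩ := exists_eigenfunction hl
  have h1 := c.eigenfunction_energy h
  have h2 := sum_wt_sq_pos (c := c) hφ
  have h3 : 0 ≤ ∑ k ∈ Finset.range n, c.conductance k * (φ k - φ (k + 1)) ^ 2 :=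
    Finset.sum_nonneg fun k _ => mul_nonneg (c.conductance_nonneg k) (sq_nonneg _)
  rw [h1] at h3
  exact lt_of_le_of_ne (nonneg_of_mul_nonneg_left h3 h2) hl.2.1.symm

lemma hermitian_spectral {ι : Type*} [Fintype ι] [DecidableEq ι] {S : Matrix ι ι ℝ}
    (hS : S.IsHermitian) :
    ∃ (b : ι → ι → ℝ) (μ : ι → ℝ), (∀ i, b i ≠ 0) ∧ (∀ i, S *ᵥ b i = μ i • b i) ∧
      ∀ g h : ι → ℝ, ∑ i, (g ⬝ᵥ b i) * (b i ⬝ᵥ h) = g ⬝ᵥ h := by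
  refine ⟨fun i => ⇑(hS.eigenvectorBasis i), hS.eigenvalues, fun i h0 => ?_,
    fun i => hS.mulVec_eigenvectorBasis i, fun g h => ?_⟩
  · apply hS.eigenvectorBasis.orthonormal.ne_zero i
    ext j
    exact congrFun h0 j
  · have := hS.eigenvectorBasis.sum_inner_mul_inner (WithLp.toLp 2 g) (WithLp.toLp 2 h)
    simpa [PiLp.inner_apply, dotProduct, mul_comm] using this

/-- The Poincaré inequality for mean zero functions. -/
lemma poincare_of_mean_zero (hl : IsSmallestNonzeroEig (1 - c.K) l) (f : ℕ → ℝ)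
    (hf : ∑ i ∈ Finset.range (n + 1), c.wt i * f i = 0) :
    l * ∑ i ∈ Finset.range (n + 1), c.wt i * f i ^ 2 ≤
      ∑ k ∈ Finset.range n, c.conductance k * (f k - f (k + 1)) ^ 2 := by
  set s : Fin (n + 1) → ℝ := fun i => Real.sqrt (c.pi i) with hs
  have hs0 : ∀ i, 0 < s i := fun i => Real.sqrt_pos.2 (c.pi_pos i)
  have hss : ∀ i, s i * s i = c.pi i := fun i => Real.mul_self_sqrt (c.pi_pos i).le
  have hrev : ∀ i j, s i * s i * c.K i j = s j * s j * c.K j i := fun i j => by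
    rw [hss, hss, ← c.wt_val, ← c.wt_val, ← c.ker_val, ← c.ker_val]
    exact c.ker_reversible i j
  set S : Matrix (Fin (n + 1)) (Fin (n + 1)) ℝ :=
    Matrix.of fun i j => s i * (1 - c.K) i j / s j with hSdef
  have hS : S.IsHermitian := by
    ext i j
    simp only [Matrix.conjTranspose_apply, hSdef, Matrix.of_apply, star_trivial]
    rw [div_eq_div_iff (hs0 _).ne' (hs0 _).ne']
    simp only [Matrix.sub_apply, Matrix.one_apply]
    have := hrev i j
    rcases eq_or_ne i j with rfl | hij
    · rfl
    · rw [if_neg hij, if_neg hij.symm]; linear_combination this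
  have hSv : ∀ v : Fin (n + 1) → ℝ, S *ᵥ (fun i => s i * v i) =
      fun i => s i * ((1 - c.K) *ᵥ v) i := by
    intro v
    ext i
    simp only [Matrix.mulVec, dotProduct, Finset.mul_sum, hSdef, Matrix.of_apply]
    refine Finset.sum_congr rfl fun j _ => ?_
    have := (hs0 j).ne'
    field_simp
  obtain ⟨b, μ, hb, hbS, hpars⟩ := hermitian_spectral hS
  set g : Fin (n + 1) → ℝ := fun i => s i * f i with hg
  have hL : ∑ i ∈ Finset.range (n + 1), c.wt i * f i ^ 2 = g ⬝ᵥ g := by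
    rw [← sum_fin_eq_range]
    refine Finset.sum_congr rfl fun i _ => ?_
    rw [c.wt_val, ← hss]; ring
  have hR : ∑ k ∈ Finset.range n, c.conductance k * (f k - f (k + 1)) ^ 2 = g ⬝ᵥ (S *ᵥ g) := by
    rw [← c.dirichlet, ← sum_fin_eq_range fun i => c.wt i * (f i * (f i - c.avg f i)), hg,
      hSv fun i => f i]
    refine Finset.sum_congr rfl fun i _ => ?_
    simp only [c.one_sub_K_mulVec f i, c.wt_val, ← hss]; ring
  rw [hL, hR, ← hpars, ← hpars, Finset.mul_sum]
  refine Finset.sum_le_sum fun i _ => ?_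
  have h1 : b i ⬝ᵥ (S *ᵥ g) = μ i * (b i ⬝ᵥ g) := by
    have hT : Sᵀ = S := by
      rw [← Matrix.conjTranspose_eq_transpose_of_trivial]; exact hS
    rw [Matrix.dotProduct_mulVec, ← Matrix.mulVec_transpose, hT, hbS, smul_dotProduct, smul_eq_mul]
  rw [h1, dotProduct_comm g (b i)]
  set v : Fin (n + 1) → ℝ := fun j => b i j / s j with hv
  have hbv : b i = fun j => s j * v j := by
    ext j; have := (hs0 j).ne'; simp only [hv]; field_simp
  have hvK : (1 - c.K) *ᵥ v = μ i • v := by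
    have h2 := hbS i
    rw [hbv, hSv] at h2
    ext j
    have h3 := congrFun h2 j
    simp only [Pi.smul_apply, smul_eq_mul] at h3 ⊢
    apply mul_left_cancel₀ (hs0 j).ne'
    linarith
  by_cases hμ : μ i = 0
  · have h0 := c.eq_of_energy_eq_zero (φ := extend v) (by
      rw [c.eigenfunction_energy fun k hk => c.eigenfunction_extend hvK hk, hμ, zero_mul])
    have h2 : b i ⬝ᵥ g = 0 := by
      have : b i ⬝ᵥ g = extend v 0 * ∑ i ∈ Finset.range (n + 1), c.wt i * f i := by
        rw [← sum_fin_eq_range, Finset.mul_sum]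
        refine Finset.sum_congr rfl fun j _ => ?_
        rw [hbv, ← h0 j j.isLt, c.wt_val, ← hss]
        simp only [hg, extend, j.isLt, dif_pos, Fin.eta]
        ring
      rw [this, hf, mul_zero]
    simp [h2]
  · have hle : l ≤ μ i := hl.2.2 _ ⟨v, fun h => hb i (by rw [hbv, h]; ext; simp), hvK⟩ hμ
    nlinarith [sq_nonneg (b i ⬝ᵥ g)]

/-- The Poincaré inequality. -/
lemma poincare (hl : IsSmallestNonzeroEig (1 - c.K) l) (f : ℕ → ℝ) :
    l * (∑ i ∈ Finset.range (n + 1), c.wt i * f i ^ 2 -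
        (∑ i ∈ Finset.range (n + 1), c.wt i * f i) ^ 2) ≤
      ∑ k ∈ Finset.range n, c.conductance k * (f k - f (k + 1)) ^ 2 := by
  set a := ∑ i ∈ Finset.range (n + 1), c.wt i * f i with ha
  have h := poincare_of_mean_zero hl (fun i => f i - a) (by
    simp only [mul_sub, Finset.sum_sub_distrib, ← Finset.sum_mul, c.sum_wt, ← ha]; ring)
  have h2 : ∑ i ∈ Finset.range (n + 1), c.wt i * (f i - a) ^ 2 =
      ∑ i ∈ Finset.range (n + 1), c.wt i * f i ^ 2 - a ^ 2 := by
    have : ∀ i, c.wt i * (f i - a) ^ 2 = c.wt i * f i ^ 2 - (c.wt i * f i) * (2 * a)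
        + c.wt i * a ^ 2 := fun i => by ring
    simp only [this, Finset.sum_add_distrib, Finset.sum_sub_distrib, ← Finset.sum_mul, c.sum_wt,
      ← ha]
    ring
  rw [h2] at h
  simpa using h

end BDChain

namespace BDChain

variable {n : ℕ} (c : BDChain n)

/-- The expected time to climb from `0` to `M`. -/
def climbMean (M : ℕ) : ℝ := ∑ z ∈ Finset.range M, c.cum z / c.conductance z

/-- The variance of the time to climb from `0` to `M`. -/
def climbVar (M : ℕ) : ℝ :=
  ∑ z ∈ Finset.range M, ∑ u ∈ Finset.range M,
    c.cum (min z u) ^ 2 / (c.conductance z * c.conductance u)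

/-- The solution of the Poisson equation `(I - K) f = g` on `[0, M)` vanishing at `M`. -/
def poissonSol (g : ℕ → ℝ) (M x : ℕ) : ℝ :=
  ∑ z ∈ Finset.Ico x M, (∑ y ∈ Finset.range (z + 1), c.wt y * g y) / c.conductance z

lemma poissonSol_sub_succ (g : ℕ → ℝ) {M x : ℕ} (h : x < M) :
    c.poissonSol g M x - c.poissonSol g M (x + 1) =
      (∑ y ∈ Finset.range (x + 1), c.wt y * g y) / c.conductance x := by
  rw [poissonSol, Finset.sum_eq_sum_Ico_succ_bot h, poissonSol]; ring

lemma poissonSol_self (g : ℕ → ℝ) (M : ℕ) : c.poissonSol g M M = 0 := by simp [poissonSol]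

lemma poissonSol_nonneg {g : ℕ → ℝ} (hg : ∀ y, 0 ≤ g y) (M x : ℕ) : 0 ≤ c.poissonSol g M x :=
  Finset.sum_nonneg fun z _ => div_nonneg
    (Finset.sum_nonneg fun y _ => mul_nonneg (c.wt_nonneg y) (hg y)) (c.conductance_nonneg z)

lemma poissonSol_eq (g : ℕ → ℝ) {M x : ℕ} (hM : M ≤ n) (h : x < M) :
    c.poissonSol g M x - c.avg (c.poissonSol g M) x = g x := by
  have hw := (c.wt_pos (show x < n + 1 by omega)).ne'
  have hc : ∀ k < M, c.conductance k ≠ 0 := fun k hk => (c.conductance_pos (by omega)).ne'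
  apply mul_left_cancel₀ hw
  cases x with
  | zero =>
    rw [wt_mul_gen_zero, c.poissonSol_sub_succ g h, mul_div_cancel₀ _ (hc _ h)]; simp
  | succ x =>
    rw [wt_mul_gen_succ, c.poissonSol_sub_succ g h, c.poissonSol_sub_succ g (by omega),
      mul_div_cancel₀ _ (hc _ h), mul_div_cancel₀ _ (hc _ (by omega)), Finset.sum_range_succ]
    ring

lemma poissonSol_one_zero (M : ℕ) : c.poissonSol (fun _ => 1) M 0 = c.climbMean M := by
  simp [poissonSol, climbMean, cum]

lemma sum_ite_le_eq_cum (z u : ℕ) :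
    ∑ y ∈ Finset.range (z + 1), (if y ≤ u then c.wt y else 0) = c.cum (min z u) := by
  rw [← Finset.sum_filter, cum]
  congr 1
  ext y; simp only [Finset.mem_filter, Finset.mem_range]; omega

lemma sum_Ico_eq_sum_ite (F : ℕ → ℝ) (x M : ℕ) :
    ∑ z ∈ Finset.Ico x M, F z = ∑ z ∈ Finset.range M, if x ≤ z then F z else 0 := by
  rw [← Finset.sum_filter]
  congr 1
  ext y; simp only [Finset.mem_filter, Finset.mem_range, Finset.mem_Ico]; omega

lemma sum_wt_mul_sum_Ico (F : ℕ → ℝ) (z M : ℕ) :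
    ∑ y ∈ Finset.range (z + 1), c.wt y * ∑ u ∈ Finset.Ico y M, F u =
      ∑ u ∈ Finset.range M, c.cum (min z u) * F u := by
  simp only [sum_Ico_eq_sum_ite, Finset.mul_sum]
  rw [Finset.sum_comm]
  refine Finset.sum_congr rfl fun u _ => ?_
  rw [← sum_ite_le_eq_cum, Finset.sum_mul]
  refine Finset.sum_congr rfl fun y _ => ?_
  split_ifs <;> simp

lemma poissonSol_second (M : ℕ) :
    c.poissonSol (fun y => 2 * c.poissonSol (fun _ => 1) M y) M 0 - c.climbMean M ^ 2 =
      c.climbVar M := by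
  have h1 : c.poissonSol (fun y => 2 * c.poissonSol (fun _ => 1) M y) M 0 =
      ∑ z ∈ Finset.range M, ∑ u ∈ Finset.range M,
        2 * (c.cum (min z u) * c.cum u / (c.conductance z * c.conductance u)) := by
    rw [poissonSol, ← Finset.range_eq_Ico]
    refine Finset.sum_congr rfl fun z _ => ?_
    have : ∀ y, c.wt y * (2 * c.poissonSol (fun _ => 1) M y) =
        2 * (c.wt y * ∑ u ∈ Finset.Ico y M, c.cum u / c.conductance u) := fun y => by
      simp only [poissonSol, cum, mul_one]; ring
    simp only [this]
    rw [← Finset.mul_sum, sum_wt_mul_sum_Ico, Finset.mul_sum, Finset.sum_div]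
    refine Finset.sum_congr rfl fun u _ => ?_
    rw [mul_div_assoc, ← mul_div_assoc (c.cum _), div_div, mul_comm (c.conductance u)]
  have h2 : ∑ z ∈ Finset.range M, ∑ u ∈ Finset.range M,
        2 * (c.cum (min z u) * c.cum u / (c.conductance z * c.conductance u)) =
      ∑ z ∈ Finset.range M, ∑ u ∈ Finset.range M,
        (c.cum (min z u) * (c.cum u + c.cum z) / (c.conductance z * c.conductance u)) := by
    have h3 : ∑ z ∈ Finset.range M, ∑ u ∈ Finset.range M,
        (c.cum (min z u) * c.cum z / (c.conductance z * c.conductance u)) =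
        ∑ z ∈ Finset.range M, ∑ u ∈ Finset.range M,
        (c.cum (min z u) * c.cum u / (c.conductance z * c.conductance u)) := by
      rw [Finset.sum_comm]
      refine Finset.sum_congr rfl fun z _ => Finset.sum_congr rfl fun u _ => ?_
      rw [min_comm, mul_comm (c.conductance u)]
    simp only [mul_add, add_div, Finset.sum_add_distrib, h3, ← Finset.mul_sum]
    ring
  rw [h1, h2, climbMean, sq, Finset.sum_mul_sum, climbVar, ← Finset.sum_sub_distrib]
  refine Finset.sum_congr rfl fun z _ => ?_
  rw [← Finset.sum_sub_distrib]
  refine Finset.sum_congr rfl fun u _ => ?_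
  rw [div_mul_div_comm, ← sub_div]
  congr 1
  rcases le_total z u with h | h
  · rw [min_eq_left h]; ring
  · rw [min_eq_right h]; ring

lemma climbMean_succ (M : ℕ) :
    c.climbMean (M + 1) = c.climbMean M + c.cum M / c.conductance M := by
  rw [climbMean, Finset.sum_range_succ]; rfl

lemma cum_div_nonneg (z : ℕ) : 0 ≤ c.cum z / c.conductance z :=
  div_nonneg (c.cum_pos z).le (c.conductance_nonneg z)

lemma climbMean_nonneg (M : ℕ) : 0 ≤ c.climbMean M :=
  Finset.sum_nonneg fun z _ => c.cum_div_nonneg z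

lemma climbMean_mono : Monotone c.climbMean :=
  monotone_nat_of_le_succ fun M => by
    rw [climbMean_succ]; linarith [c.cum_div_nonneg M]

lemma climbVar_succ (M : ℕ) :
    c.climbVar (M + 1) = c.climbVar M + (c.cum M / c.conductance M) ^ 2 +
      2 * ((∑ z ∈ Finset.range M, c.cum z ^ 2 / c.conductance z) / c.conductance M) := by
  have h1 : ∀ z ∈ Finset.range M, c.cum (min z M) ^ 2 / (c.conductance z * c.conductance M) =
      c.cum z ^ 2 / c.conductance z / c.conductance M := fun z hz => by
    rw [min_eq_left (Finset.mem_range.1 hz).le, div_div]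
  have h2 : ∀ z ∈ Finset.range M, c.cum (min M z) ^ 2 / (c.conductance M * c.conductance z) =
      c.cum z ^ 2 / c.conductance z / c.conductance M := fun z hz => by
    rw [min_eq_right (Finset.mem_range.1 hz).le, div_div, mul_comm (c.conductance z)]
  simp only [climbVar, Finset.sum_range_succ, Finset.sum_add_distrib]
  rw [Finset.sum_congr rfl h1, Finset.sum_congr rfl h2, ← Finset.sum_div, min_self]
  ring

lemma climbVar_mono : Monotone c.climbVar :=
  monotone_nat_of_le_succ fun M => by
    rw [climbVar_succ]
    have : 0 ≤ (∑ z ∈ Finset.range M, c.cum z ^ 2 / c.conductance z) / c.conductance M :=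
      div_nonneg (Finset.sum_nonneg fun z _ => div_nonneg (sq_nonneg _) (c.conductance_nonneg z))
        (c.conductance_nonneg M)
    nlinarith [sq_nonneg (c.cum M / c.conductance M)]

lemma climbVar_nonneg (M : ℕ) : 0 ≤ c.climbVar M := by
  have := c.climbVar_mono (Nat.zero_le M)
  simpa [climbVar] using this

variable {c} {l : ℝ}

/-- The Dirichlet eigenvalue bound for functions supported on `[0, x]`. -/
lemma poincare_of_support (hl : IsSmallestNonzeroEig (1 - c.K) l) {f : ℕ → ℝ} {x : ℕ} (hx : x < n)
    (hf : ∀ y, x < y → f y = 0) :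
    l * (1 - c.cum x) * ∑ i ∈ Finset.range (x + 1), c.wt i * f i ^ 2 ≤
      ∑ k ∈ Finset.range (x + 1), c.conductance k * (f k - f (k + 1)) ^ 2 := by
  have h := poincare hl f
  have hsub : Finset.range (x + 1) ⊆ Finset.range (n + 1) := by simp; omega
  rw [← Finset.sum_subset hsub, ← Finset.sum_subset hsub,
    ← Finset.sum_subset (s₁ := Finset.range (x + 1)) (s₂ := Finset.range n)] at h
  · have hcs : (∑ i ∈ Finset.range (x + 1), c.wt i * f i) ^ 2 ≤
        c.cum x * ∑ i ∈ Finset.range (x + 1), c.wt i * f i ^ 2 :=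
      Finset.sum_sq_le_sum_mul_sum_of_sq_le_mul _ (fun i _ => c.wt_nonneg i)
        (fun i _ => mul_nonneg (c.wt_nonneg i) (sq_nonneg _)) (fun i _ => le_of_eq (by ring))
    have := mul_le_mul_of_nonneg_left hcs (gap_pos hl).le
    linarith
  · simp; omega
  · intro y _ hy
    rw [hf y (by simp at hy; omega), hf (y + 1) (by simp at hy; omega)]; ring
  · intro y _ hy
    rw [hf y (by simp at hy; omega)]; ring
  · intro y _ hy
    rw [hf y (by simp at hy; omega)]; ring

lemma sum_inv_conductance_le (hl : IsSmallestNonzeroEig (1 - c.K) l) {a x : ℕ} (hx : x < n)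
    (hax : a ≤ x) :
    l * (1 - c.cum x) * c.cum a * ∑ z ∈ Finset.Ico a (x + 1), (c.conductance z)⁻¹ ≤ 1 := by
  set f : ℕ → ℝ := fun y => ∑ z ∈ Finset.Ico (max y a) (x + 1), (c.conductance z)⁻¹ with hf
  set L := ∑ z ∈ Finset.Ico a (x + 1), (c.conductance z)⁻¹ with hL
  have hpos : ∀ z ∈ Finset.Ico a (x + 1), 0 < (c.conductance z)⁻¹ := fun z hz =>
    inv_pos.2 (c.conductance_pos (by simp at hz; omega))
  have hLpos : 0 < L := Finset.sum_pos hpos ⟨a, by simp; omega⟩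
  have h := poincare_of_support hl hx (f := f) (fun y hy => by
    simp only [hf]; rw [Finset.Ico_eq_empty (by omega), Finset.sum_empty])
  have hE : ∑ k ∈ Finset.range (x + 1), c.conductance k * (f k - f (k + 1)) ^ 2 = L := by
    rw [hL, sum_Ico_eq_sum_ite]
    refine Finset.sum_congr rfl fun k hk => ?_
    have hk' := Finset.mem_range.1 hk
    split_ifs with hak
    · have : f k - f (k + 1) = (c.conductance k)⁻¹ := by
        simp only [hf]
        rw [max_eq_left hak, max_eq_left (by omega), Finset.sum_eq_sum_Ico_succ_bot hk']; ring
      have h0 := (c.conductance_pos (show k < n by omega)).ne'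
      rw [this]; field_simp
    · simp only [hf]
      rw [max_eq_right (by omega), max_eq_right (by omega)]; ring
  have hS : c.cum a * L ^ 2 ≤ ∑ i ∈ Finset.range (x + 1), c.wt i * f i ^ 2 := by
    rw [cum, Finset.sum_mul]
    refine le_trans (le_of_eq ?_) (Finset.sum_le_sum_of_subset_of_nonneg
      (s := Finset.range (a + 1)) (by simp; omega)
      fun i _ _ => mul_nonneg (c.wt_nonneg i) (sq_nonneg _))
    refine Finset.sum_congr rfl fun i hi => ?_
    simp only [hf]
    rw [max_eq_right (by simp at hi; omega)]
  rw [hE] at h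
  have h0 : 0 ≤ l * (1 - c.cum x) :=
    mul_nonneg (gap_pos hl).le (by linarith [c.cum_lt_one hx])
  have h1 := (mul_le_mul_of_nonneg_left hS h0).trans h
  apply le_of_mul_le_mul_right _ hLpos
  linarith

lemma sum_cum_sq_div_le (hl : IsSmallestNonzeroEig (1 - c.K) l) {x : ℕ} (hx : x < n) :
    l * (1 - c.cum x) * ∑ z ∈ Finset.range (x + 1), c.cum z ^ 2 / c.conductance z ≤ c.cum x := by
  set f : ℕ → ℝ := fun y => ∑ z ∈ Finset.Ico y (x + 1), c.cum z / c.conductance z with hf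
  set E := ∑ z ∈ Finset.range (x + 1), c.cum z ^ 2 / c.conductance z with hE
  have hEpos : 0 < E := Finset.sum_pos (fun z hz =>
    div_pos (pow_pos (c.cum_pos z) 2) (c.conductance_pos (by simp at hz; omega))) ⟨0, by simp⟩
  have h := poincare_of_support hl hx (f := f) (fun y hy => by
    simp only [hf]; rw [Finset.Ico_eq_empty (by omega), Finset.sum_empty])
  have hE1 : ∑ k ∈ Finset.range (x + 1), c.conductance k * (f k - f (k + 1)) ^ 2 = E := by
    refine Finset.sum_congr rfl fun k hk => ?_
    have hk' := Finset.mem_range.1 hk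
    have : f k - f (k + 1) = c.cum k / c.conductance k := by
      simp only [hf]
      rw [Finset.sum_eq_sum_Ico_succ_bot hk']; ring
    have h0 := (c.conductance_pos (show k < n by omega)).ne'
    rw [this]; field_simp
  have hS : ∑ i ∈ Finset.range (x + 1), c.wt i * f i = E := by
    rw [sum_wt_mul_sum_Ico]
    refine Finset.sum_congr rfl fun k hk => ?_
    rw [min_eq_right (by simp at hk; omega)]; ring
  have hcs : (∑ i ∈ Finset.range (x + 1), c.wt i * f i) ^ 2 ≤
      c.cum x * ∑ i ∈ Finset.range (x + 1), c.wt i * f i ^ 2 :=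
    Finset.sum_sq_le_sum_mul_sum_of_sq_le_mul _ (fun i _ => c.wt_nonneg i)
      (fun i _ => mul_nonneg (c.wt_nonneg i) (sq_nonneg _)) (fun i _ => le_of_eq (by ring))
  rw [hE1] at h
  rw [hS] at hcs
  have h0 : 0 ≤ l * (1 - c.cum x) :=
    mul_nonneg (gap_pos hl).le (by linarith [c.cum_lt_one hx])
  have h1 := mul_le_mul_of_nonneg_left hcs h0
  have h2 := mul_le_mul_of_nonneg_left h (c.cum_pos x).le
  apply le_of_mul_le_mul_right _ hEpos
  linarith

lemma climbVar_succ_sub_le (hl : IsSmallestNonzeroEig (1 - c.K) l) {x : ℕ} (hx : x < n) :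
    l * (1 - c.cum x) * (c.climbVar (x + 1) - c.climbVar x) ≤
      2 * (c.cum x / c.conductance x) := by
  have h := sum_cum_sq_div_le hl hx
  have hc := c.conductance_pos hx
  have h0 : 0 ≤ l * (1 - c.cum x) :=
    mul_nonneg (gap_pos hl).le (by linarith [c.cum_lt_one hx])
  have h1 : c.climbVar (x + 1) - c.climbVar x ≤
      2 * ((∑ z ∈ Finset.range (x + 1), c.cum z ^ 2 / c.conductance z) / c.conductance x) := by
    rw [climbVar_succ, Finset.sum_range_succ, add_div, div_div, div_pow, ← sq]
    have : 0 ≤ c.cum x ^ 2 / c.conductance x ^ 2 := by positivity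
    linarith
  refine (mul_le_mul_of_nonneg_left h1 h0).trans ?_
  rw [mul_left_comm, ← mul_div_assoc]
  gcongr

lemma climbVar_sub_le (hl : IsSmallestNonzeroEig (1 - c.K) l) {δ : ℝ} {a b : ℕ}
    (hab : a ≤ b) (hb : b ≤ n) (h : ∀ z < b, δ ≤ 1 - c.cum z) :
    l * δ * (c.climbVar b - c.climbVar a) ≤ 2 * (c.climbMean b - c.climbMean a) := by
  induction b, hab using Nat.le_induction with
  | base => simp
  | succ b hab ih =>
    have h1 := ih (by omega) fun z hz => h z (by omega)
    have h2 := climbVar_succ_sub_le hl (show b < n by omega)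
    have h3 : l * δ * (c.climbVar (b + 1) - c.climbVar b) ≤
        l * (1 - c.cum b) * (c.climbVar (b + 1) - c.climbVar b) := by
      have := c.climbVar_mono (Nat.le_succ b)
      have h4 := h b (by omega)
      have := (gap_pos hl).le
      gcongr
    rw [climbMean_succ]
    linarith

lemma climbMean_sub_le (hl : IsSmallestNonzeroEig (1 - c.K) l) {δ ε : ℝ} (hδ : 0 < δ) (hε : 0 < ε)
    {a b : ℕ} (hab : a ≤ b) (hb : b ≤ n) (h : ∀ z < b, δ ≤ 1 - c.cum z) (ha : ε ≤ c.cum a) :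
    l * δ * ε * (c.climbMean b - c.climbMean a) ≤ 1 := by
  rcases hab.eq_or_lt with rfl | hlt
  · simp
  obtain ⟨x, rfl⟩ : ∃ x, b = x + 1 := ⟨b - 1, by omega⟩
  have h1 := sum_inv_conductance_le hl (show x < n by omega) (show a ≤ x by omega)
  have hl0 := gap_pos hl
  have h2 : c.climbMean (x + 1) - c.climbMean a ≤
      ∑ z ∈ Finset.Ico a (x + 1), (c.conductance z)⁻¹ := by
    rw [climbMean, climbMean, ← Finset.sum_Ico_eq_sub _ hab]
    refine Finset.sum_le_sum fun z hz => ?_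
    rw [div_eq_mul_inv]
    have := c.cum_lt_one (show z < n by simp at hz; omega)
    exact mul_le_of_le_one_left (inv_nonneg.2 (c.conductance_nonneg z)) this.le
  have h3 : 0 ≤ ∑ z ∈ Finset.Ico a (x + 1), (c.conductance z)⁻¹ :=
    Finset.sum_nonneg fun z _ => inv_nonneg.2 (c.conductance_nonneg z)
  refine le_trans ?_ h1
  have h4 := h x (by omega)
  have h5 := sub_nonneg.2 (c.climbMean_mono hab)
  have h6 := c.cum_pos a
  have h7 : l * δ * ε ≤ l * (1 - c.cum x) * c.cum a :=
    mul_le_mul (mul_le_mul_of_nonneg_left h4 hl0.le) ha hε.le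
      (mul_nonneg hl0.le (by linarith))
  exact mul_le_mul h7 h2 h5 ((by positivity : 0 ≤ l * δ * ε).trans h7)

/-- Control of an eigenfunction on `[0, M]` by the climbing variance. -/
lemma eigenfunction_climb {φ : ℕ → ℝ} {M : ℕ} (hM : M ≤ n)
    (h : ∀ i < n + 1, φ i - c.avg φ i = l * φ i) :
    ∑ x ∈ Finset.range M, c.wt x * (φ x - φ M) ^ 2 ≤
      l ^ 2 * c.climbVar M * ∑ y ∈ Finset.range M, c.wt y * φ y ^ 2 := by
  set g : ℕ → ℕ → ℝ := fun x y => ∑ z ∈ Finset.Ico (max x y) M, (c.conductance z)⁻¹ with hg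
  have hstep : ∀ z < M, φ z - φ (z + 1) =
      l * ((c.conductance z)⁻¹ * ∑ y ∈ Finset.range (z + 1), c.wt y * φ y) := by
    intro z hz
    have h0 := (c.conductance_pos (show z < n by omega)).ne'
    have h1 := c.sum_wt_mul_gen φ z
    have h2 : ∑ y ∈ Finset.range (z + 1), c.wt y * (φ y - c.avg φ y) =
        l * ∑ y ∈ Finset.range (z + 1), c.wt y * φ y := by
      rw [Finset.mul_sum]
      refine Finset.sum_congr rfl fun y hy => ?_
      rw [h y (by simp at hy; omega)]; ring
    rw [h2] at h1
    rw [mul_left_comm, h1, inv_mul_cancel_left₀ h0]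
  have hrep : ∀ x ≤ M, φ x - φ M = l * ∑ y ∈ Finset.range M, c.wt y * φ y * g x y := by
    intro x hx
    have h1 : φ x - φ M = ∑ z ∈ Finset.Ico x M, (φ z - φ (z + 1)) := by
      have := Finset.sum_Ico_sub φ hx
      rw [← neg_inj, ← Finset.sum_neg_distrib]
      simpa using this.symm
    rw [h1, Finset.sum_congr rfl fun z hz => hstep z (Finset.mem_Ico.1 hz).2, ← Finset.mul_sum,
      sum_Ico_eq_sum_ite]
    congr 1
    simp only [hg, sum_Ico_eq_sum_ite, Finset.mul_sum]
    rw [Finset.sum_comm]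
    refine Finset.sum_congr rfl fun z hz => ?_
    split_ifs with hxz
    · rw [← Finset.sum_subset (s₁ := Finset.range (z + 1))
        (s₂ := Finset.range M) (by simp at hz ⊢; omega)]
      · refine Finset.sum_congr rfl fun y hy => ?_
        rw [if_pos (by simp at hy; omega)]; ring
      · intro y _ hy
        rw [if_neg (by simp at hy; omega), mul_zero]
    · symm
      refine Finset.sum_eq_zero fun y _ => ?_
      rw [if_neg (by omega), mul_zero]
  have hV : ∑ x ∈ Finset.range M, c.wt x * ∑ y ∈ Finset.range M, c.wt y * g x y ^ 2 =
      c.climbVar M := by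
    have h1 : ∀ x y, c.wt x * (c.wt y * g x y ^ 2) =
        ∑ z ∈ Finset.range M, ∑ u ∈ Finset.range M,
          ((if x ≤ min z u then c.wt x else 0) * (if y ≤ min z u then c.wt y else 0)) *
            ((c.conductance z)⁻¹ * (c.conductance u)⁻¹) := by
      intro x y
      rw [hg]
      simp only [sum_Ico_eq_sum_ite]
      rw [sq, Finset.sum_mul_sum]
      simp only [Finset.mul_sum]
      refine Finset.sum_congr rfl fun z _ => Finset.sum_congr rfl fun u _ => ?_
      by_cases h1 : x ≤ z <;> by_cases h2 : x ≤ u <;> by_cases h3 : y ≤ z <;>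
        by_cases h4 : y ≤ u <;> simp [h1, h2, h3, h4]
      ring
    have h2 : ∀ v < M, ∑ x ∈ Finset.range M, (if x ≤ v then c.wt x else 0) = c.cum v := by
      intro v hv
      obtain ⟨N, rfl⟩ : ∃ N, M = N + 1 := ⟨M - 1, by omega⟩
      rw [sum_ite_le_eq_cum, min_eq_right (by omega)]
    simp only [Finset.mul_sum, h1]
    rw [climbVar]
    have h3 : ∀ F : ℕ → ℕ → ℕ → ℕ → ℝ, ∑ x ∈ Finset.range M, ∑ y ∈ Finset.range M,
        ∑ z ∈ Finset.range M, ∑ u ∈ Finset.range M, F x y z u =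
        ∑ z ∈ Finset.range M, ∑ u ∈ Finset.range M,
        ∑ x ∈ Finset.range M, ∑ y ∈ Finset.range M, F x y z u := by
      intro F
      rw [Finset.sum_congr rfl fun x _ => Finset.sum_comm, Finset.sum_comm]
      refine Finset.sum_congr rfl fun z _ => ?_
      rw [Finset.sum_congr rfl fun x _ => Finset.sum_comm, Finset.sum_comm]
    rw [h3]
    refine Finset.sum_congr rfl fun z hz => Finset.sum_congr rfl fun u _ => ?_
    simp only [← Finset.sum_mul, ← Finset.mul_sum]
    rw [h2 _ (by simp at hz; omega), div_eq_mul_inv, mul_inv, sq]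
  rw [← hV, Finset.mul_sum (Finset.range M) _ (l ^ 2), Finset.sum_mul]
  refine Finset.sum_le_sum fun x hx => ?_
  rw [hrep x (Finset.mem_range.1 hx).le]
  have hcs : (∑ y ∈ Finset.range M, c.wt y * φ y * g x y) ^ 2 ≤
      (∑ y ∈ Finset.range M, c.wt y * g x y ^ 2) * ∑ y ∈ Finset.range M, c.wt y * φ y ^ 2 :=
    Finset.sum_sq_le_sum_mul_sum_of_sq_le_mul _
      (fun i _ => mul_nonneg (c.wt_nonneg i) (sq_nonneg _))
      (fun i _ => mul_nonneg (c.wt_nonneg i) (sq_nonneg _)) (fun i _ => le_of_eq (by ring))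
  have := mul_le_mul_of_nonneg_left hcs (mul_nonneg (sq_nonneg l) (c.wt_nonneg x))
  linarith

end BDChain

namespace BDChain

variable {n : ℕ} (c : BDChain n)

lemma hitSurv_self (i : Fin (n + 1)) (m : ℕ) : c.hitSurv i i m = 0 := by simp [hitSurv]

lemma hitSurv_zero (i j : Fin (n + 1)) : c.hitSurv i j 0 = if j = i then 0 else 1 := by
  simp [hitSurv, Matrix.one_apply]

lemma hitSurv_succ (i j : Fin (n + 1)) (m : ℕ) : c.hitSurv i j (m + 1) =
    if j = i then 0 else ∑ y, c.K j y * c.hitSurv i y m := by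
  rw [hitSurv]
  split_ifs with hj
  · rfl
  simp only [pow_succ', Matrix.mul_apply]
  rw [Finset.sum_comm]
  refine Finset.sum_congr rfl fun z _ => ?_
  rw [← Finset.mul_sum, hitSurv]
  by_cases hz : z = i <;> simp [killed, hz, hj]

lemma hitSurv_mem (i : Fin (n + 1)) (m : ℕ) : ∀ j, 0 ≤ c.hitSurv i j m ∧ c.hitSurv i j m ≤ 1 := by
  induction m with
  | zero => intro j; rw [hitSurv_zero]; split_ifs <;> norm_num
  | succ m ih =>
    intro j
    rw [hitSurv_succ]
    split_ifs
    · norm_num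
    refine ⟨Finset.sum_nonneg fun y _ => mul_nonneg (c.K_nonneg _ _) (ih y).1, ?_⟩
    rw [← c.K_rowSum j]
    exact Finset.sum_le_sum fun y _ => mul_le_of_le_one_right (c.K_nonneg _ _) (ih y).2

lemma hitSurv_nonneg (i j : Fin (n + 1)) (m : ℕ) : 0 ≤ c.hitSurv i j m := (c.hitSurv_mem i m j).1

lemma hitSurv_le_one (i j : Fin (n + 1)) (m : ℕ) : c.hitSurv i j m ≤ 1 := (c.hitSurv_mem i m j).2

/-- The chain with the order of the states reversed. -/
def rev : BDChain n where
  K := Matrix.of fun i j => c.K i.rev j.rev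
  pi i := c.pi i.rev
  K_nonneg i j := c.K_nonneg _ _
  K_rowSum i := by
    rw [← c.K_rowSum i.rev]
    exact Equiv.sum_comp Fin.revPerm fun j => c.K i.rev j
  K_tridiag i j h := by
    apply c.K_tridiag
    simp only [Fin.val_rev]
    rw [lt_abs] at h ⊢
    omega
  K_irred i h := by
    have := c.K_irred (n - 1 - i) (by omega)
    have h1 : (⟨i, by omega⟩ : Fin (n + 1)).rev = ⟨n - 1 - i + 1, by omega⟩ := by
      ext; simp only [Fin.val_rev]; omega
    have h2 : (⟨i + 1, by omega⟩ : Fin (n + 1)).rev = ⟨n - 1 - i, by omega⟩ := by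
      ext; simp only [Fin.val_rev]; omega
    simp only [Matrix.of_apply, h1, h2]
    exact ⟨this.2, this.1⟩
  pi_pos i := c.pi_pos _
  pi_sum := by
    rw [← c.pi_sum]
    exact Equiv.sum_comp Fin.revPerm c.pi
  pi_stat j := by
    rw [← c.pi_stat j.rev]
    exact Equiv.sum_comp Fin.revPerm fun i => c.pi i * c.K i j.rev

lemma rev_K (i j : Fin (n + 1)) : c.rev.K i j = c.K i.rev j.rev := rfl

lemma rev_pi (i : Fin (n + 1)) : c.rev.pi i = c.pi i.rev := rfl

lemma sum_rev (F : Fin (n + 1) → ℝ) : ∑ i : Fin (n + 1), F i.rev = ∑ i, F i :=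
  Equiv.sum_comp Fin.revPerm F

lemma rev_hitSurv (i j : Fin (n + 1)) (m : ℕ) :
    c.rev.hitSurv i j m = c.hitSurv i.rev j.rev m := by
  induction m generalizing j with
  | zero => simp [hitSurv_zero]
  | succ m ih =>
    rw [hitSurv_succ, hitSurv_succ, ← sum_rev fun y => c.K j.rev y * c.hitSurv i.rev y m]
    simp [ih, rev_K]

lemma rev_hitSurvC (i j : Fin (n + 1)) (t : ℝ) :
    c.rev.hitSurvC i j t = c.hitSurvC i.rev j.rev t := by
  simp only [hitSurvC, rev_hitSurv]

lemma rev_hitMeanC (i j : Fin (n + 1)) : c.rev.hitMeanC i j = c.hitMeanC i.rev j.rev := by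
  simp only [hitMeanC, rev_hitSurvC]

lemma rev_hitVarC (i j : Fin (n + 1)) : c.rev.hitVarC i j = c.hitVarC i.rev j.rev := by
  simp only [hitVarC, rev_hitSurvC, rev_hitMeanC]

lemma rev_K_pow (m : ℕ) (i j : Fin (n + 1)) : (c.rev.K ^ m) i j = (c.K ^ m) i.rev j.rev := by
  induction m generalizing i with
  | zero => simp [Matrix.one_apply]
  | succ m ih =>
    rw [pow_succ', pow_succ', Matrix.mul_apply, Matrix.mul_apply,
      ← sum_rev fun y => c.K i.rev y * (c.K ^ m) y j.rev]
    simp [ih, rev_K]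

lemma rev_Ht (t : ℝ) (i j : Fin (n + 1)) : c.rev.Ht t i j = c.Ht t i.rev j.rev := by
  simp only [Ht, rev_K_pow]

lemma rev_dTVC (x : Fin (n + 1)) (t : ℝ) : c.rev.dTVC x t = c.dTVC x.rev t := by
  unfold dTVC
  refine Equiv.iSup_congr (Fin.revPerm.finsetCongr) fun A => ?_
  simp [Finset.sum_map, rev_Ht, rev_pi]

lemma rev_dTVMaxC (t : ℝ) : c.rev.dTVMaxC t = c.dTVMaxC t := by
  unfold dTVMaxC
  exact Equiv.iSup_congr Fin.revPerm fun x => by simp [rev_dTVC]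

lemma rev_gap {l : ℝ} (hl : IsSmallestNonzeroEig (1 - c.K) l) :
    IsSmallestNonzeroEig (1 - c.rev.K) l := by
  have key : ∀ v : Fin (n + 1) → ℝ,
      (1 - c.rev.K) *ᵥ v = fun i => ((1 - c.K) *ᵥ fun j => v j.rev) i.rev := by
    intro v
    ext i
    rw [Matrix.sub_mulVec, Matrix.sub_mulVec, Matrix.one_mulVec, Matrix.one_mulVec, Pi.sub_apply,
      Pi.sub_apply, Fin.rev_rev]
    congr 1
    simp only [Matrix.mulVec, dotProduct, rev_K]
    rw [← sum_rev fun j => c.K i.rev j * v j.rev]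
    simp
  have hset : eigSet (1 - c.rev.K) = eigSet (1 - c.K) := by
    ext x
    constructor
    · rintro ⟨v, hv, h⟩
      refine ⟨fun j => v j.rev, fun h0 => hv ?_, ?_⟩
      · ext j; simpa using congrFun h0 j.rev
      · ext j
        have := congrFun h j.rev
        rw [key] at this
        simpa using this
    · rintro ⟨v, hv, h⟩
      refine ⟨fun j => v j.rev, fun h0 => hv ?_, ?_⟩
      · ext j; simpa using congrFun h0 j.rev
      · rw [key]
        ext j
        simp [h]
  unfold IsSmallestNonzeroEig
  rw [hset]
  exact hl

lemma rev_wt {i : ℕ} (hi : i ≤ n) : c.rev.wt i = c.wt (n - i) := by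
  simp only [wt, show i < n + 1 by omega, show n - i < n + 1 by omega, dif_pos, rev_pi]
  congr 1
  ext; simp only [Fin.val_rev]; omega

lemma rev_ker {i j : ℕ} (hi : i ≤ n) (hj : j ≤ n) : c.rev.ker i j = c.ker (n - i) (n - j) := by
  simp only [ker, show i < n + 1 ∧ j < n + 1 by omega,
    show n - i < n + 1 ∧ n - j < n + 1 by omega, and_self, dif_pos, rev_K]
  congr 1 <;> (ext; simp only [Fin.val_rev]; omega)

lemma rev_avg (f : ℕ → ℝ) {i : ℕ} (hi : i ≤ n) :
    c.rev.avg (fun k => f (n - k)) i = c.avg f (n - i) := by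
  rw [avg, avg, ← Finset.sum_range_reflect]
  refine Finset.sum_congr rfl fun j hj => ?_
  have hj' : j ≤ n := by simp at hj; omega
  rw [rev_ker _ hi (by omega), show n - (n + 1 - 1 - j) = j by omega]

lemma cum_eq_piLow (M : Fin (n + 1)) : c.cum M = c.piLow M := by
  rw [piLow, cum, ← Finset.sum_filter]
  simp only [← c.wt_val]
  have := Fin.sum_univ_eq_sum_range (fun i => if i ≤ (M : ℕ) then c.wt i else 0) (n + 1)
  rw [← Finset.sum_filter (p := fun i => i ≤ (M : ℕ)), ← Finset.sum_filter] at this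
  refine Eq.trans ?_ this.symm
  congr 1
  ext y; simp; omega

lemma rev_piLow (M : Fin (n + 1)) : c.rev.piLow M.rev = c.piHigh M := by
  rw [piLow, piHigh, ← sum_rev]
  refine Finset.sum_congr rfl fun i _ => ?_
  rw [rev_pi, Fin.rev_rev]
  simp

/-- The reciprocal of the spectral gap is at most the larger of the two standard deviations. -/
lemma one_le_gap_sq_mul_climbVar {l : ℝ} (hl : IsSmallestNonzeroEig (1 - c.K) l) {M : ℕ}
    (hM : M ≤ n) : 1 ≤ l ^ 2 * max (c.climbVar M) (c.rev.climbVar (n - M)) := by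
  obtain ⟨φ, hφ, h, hmean⟩ := exists_eigenfunction hl
  have hpos := sum_wt_sq_pos (c := c) hφ
  set V := max (c.climbVar M) (c.rev.climbVar (n - M)) with hV
  have h1 := eigenfunction_climb hM h
  have h2 := eigenfunction_climb (c := c.rev) (M := n - M) (φ := fun k => φ (n - k)) (by omega)
    (fun i hi => by rw [rev_avg _ _ (by omega)]; exact h (n - i) (by omega))
  have hrefl : ∀ F : ℕ → ℝ, ∑ x ∈ Finset.range (n - M), c.rev.wt x * F (n - x) =
      ∑ x ∈ Finset.Ico (M + 1) (n + 1), c.wt x * F x := by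
    intro F
    rw [Finset.sum_Ico_eq_sum_range, ← Finset.sum_range_reflect,
      show n + 1 - (M + 1) = n - M by omega]
    refine Finset.sum_congr rfl fun x hx => ?_
    have := Finset.mem_range.1 hx
    rw [rev_wt _ (by omega), show n - (n - M - 1 - x) = M + 1 + x by omega]
  rw [show n - (n - M) = M by omega, hrefl fun k => (φ k - φ M) ^ 2,
    hrefl fun k => φ k ^ 2] at h2
  have hsplit : ∀ F : ℕ → ℝ, ∑ x ∈ Finset.range (n + 1), F x = ∑ x ∈ Finset.range M, F x + F M +
      ∑ x ∈ Finset.Ico (M + 1) (n + 1), F x := by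
    intro F
    rw [← Finset.sum_range_succ, Finset.sum_range_add_sum_Ico _ (by omega)]
  have h3 : ∑ i ∈ Finset.range (n + 1), c.wt i * (φ i - φ M) ^ 2 =
      ∑ i ∈ Finset.range (n + 1), c.wt i * φ i ^ 2 + φ M ^ 2 := by
    have : ∀ i, c.wt i * (φ i - φ M) ^ 2 = c.wt i * φ i ^ 2 - (c.wt i * φ i) * (2 * φ M)
        + c.wt i * φ M ^ 2 := fun i => by ring
    simp only [this, Finset.sum_add_distrib, Finset.sum_sub_distrib, ← Finset.sum_mul, c.sum_wt,
      hmean]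
    ring
  have h4 : 0 ≤ ∑ y ∈ Finset.range M, c.wt y * φ y ^ 2 :=
    Finset.sum_nonneg fun y _ => mul_nonneg (c.wt_nonneg y) (sq_nonneg _)
  have h5 : 0 ≤ ∑ y ∈ Finset.Ico (M + 1) (n + 1), c.wt y * φ y ^ 2 :=
    Finset.sum_nonneg fun y _ => mul_nonneg (c.wt_nonneg y) (sq_nonneg _)
  have h6 : l ^ 2 * c.climbVar M * ∑ y ∈ Finset.range M, c.wt y * φ y ^ 2 ≤
      l ^ 2 * V * ∑ y ∈ Finset.range M, c.wt y * φ y ^ 2 := by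
    gcongr; exact le_max_left _ _
  have h7 : l ^ 2 * c.rev.climbVar (n - M) *
      ∑ y ∈ Finset.Ico (M + 1) (n + 1), c.wt y * φ y ^ 2 ≤
      l ^ 2 * V * ∑ y ∈ Finset.Ico (M + 1) (n + 1), c.wt y * φ y ^ 2 := by
    gcongr; exact le_max_right _ _
  have h8 : 0 ≤ l ^ 2 * V * (c.wt M * φ M ^ 2) :=
    mul_nonneg (mul_nonneg (sq_nonneg _) ((c.climbVar_nonneg M).trans (le_max_left _ _)))
      (mul_nonneg (c.wt_nonneg M) (sq_nonneg _))
  apply le_of_mul_le_mul_right _ hpos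
  have h9 := hsplit fun x => c.wt x * (φ x - φ M) ^ 2
  have h10 := hsplit fun x => c.wt x * φ x ^ 2
  simp only [sub_self] at h9
  rw [h3] at h9
  nlinarith [sq_nonneg (φ M)]

end BDChain

lemma integrable_tsum_of_nonneg {X : Type*} [MeasurableSpace X] {μ : Measure X}
    {F : ℕ → X → ℝ} (hF : ∀ i, Integrable (F i) μ) (h0 : ∀ i, 0 ≤ᵐ[μ] F i)
    (hs : Summable fun i => ∫ a, F i a ∂μ) (hp : ∀ᵐ a ∂μ, Summable fun i => F i a) :
    Integrable (fun a => ∑' i, F i a) μ := by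
  have hall : ∀ᵐ a ∂μ, ∀ i, 0 ≤ F i a := ae_all_iff.2 h0
  have h1 : ∫⁻ a, ∑' i, ENNReal.ofReal (F i a) ∂μ ≠ ⊤ := by
    rw [lintegral_tsum fun i => (hF i).aemeasurable.ennreal_ofReal]
    have : ∀ i, ∫⁻ a, ENNReal.ofReal (F i a) ∂μ = ENNReal.ofReal (∫ a, F i a ∂μ) := fun i =>
      (ofReal_integral_eq_lintegral_ofReal (hF i) (h0 i)).symm
    simp only [this]
    rw [← ENNReal.ofReal_tsum_of_nonneg (fun i => integral_nonneg_of_ae (h0 i)) hs]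
    exact ENNReal.ofReal_ne_top
  have h2 := integrable_toReal_of_lintegral_ne_top
    (AEMeasurable.tsum fun i => (hF i).aemeasurable.ennreal_ofReal) h1
  refine h2.congr ?_
  filter_upwards [hall, hp] with a ha hpa
  rw [← ENNReal.ofReal_tsum_of_nonneg ha hpa, ENNReal.toReal_ofReal (tsum_nonneg ha)]

lemma gamma_integrable (m : ℕ) :
    IntegrableOn (fun t : ℝ => Real.exp (-t) * t ^ m) (Set.Ioi 0) := by
  have := Real.GammaIntegral_convergent (s := (m : ℝ) + 1) (by positivity)
  simpa using this

lemma gamma_integral (m : ℕ) :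
    ∫ t in Set.Ioi (0 : ℝ), Real.exp (-t) * t ^ m = m.factorial := by
  have := Real.Gamma_eq_integral (s := (m : ℝ) + 1) (by positivity)
  rw [Real.Gamma_nat_eq_factorial] at this
  rw [this]
  simp

/-- Poisson averages `e^{-t} ∑ t^m / m! s_m` of a bounded sequence. -/
def poissonAvg (s : ℕ → ℝ) (t : ℝ) : ℝ :=
  ∑' m : ℕ, (Real.exp (-t) * t ^ m / m.factorial) * s m

lemma poisson_summable {s : ℕ → ℝ} {B : ℝ} (hs : ∀ m, |s m| ≤ B) (t : ℝ) :
    Summable fun m : ℕ => (Real.exp (-t) * t ^ m / m.factorial) * s m := by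
  refine Summable.of_norm_bounded
    (g := fun m : ℕ => (Real.exp (-t) * B) * ‖t ^ m / (m.factorial : ℝ)‖)
    ((Real.summable_pow_div_factorial t).norm.mul_left _) fun m => ?_
  rw [mul_div_assoc, norm_mul, norm_mul, Real.norm_of_nonneg (Real.exp_pos _).le,
    Real.norm_eq_abs (s m)]
  nlinarith [hs m, mul_nonneg (Real.exp_pos (-t)).le (norm_nonneg (t ^ m / (m.factorial : ℝ)))]

lemma poissonAvg_const (b t : ℝ) : poissonAvg (fun _ => b) t = b := by
  unfold poissonAvg
  rw [tsum_mul_right]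
  have : ∑' m : ℕ, Real.exp (-t) * t ^ m / (m.factorial : ℝ) = 1 := by
    simp only [mul_div_assoc]
    rw [tsum_mul_left, ← congrFun (NormedSpace.exp_eq_tsum_div (𝔸 := ℝ)) t,
      ← congrFun Real.exp_eq_exp_ℝ t, ← Real.exp_add]
    simp
  rw [this, one_mul]

lemma poissonAvg_mono {s s' : ℕ → ℝ} {B B' : ℝ} (hs : ∀ m, |s m| ≤ B) (hs' : ∀ m, |s' m| ≤ B')
    (h : ∀ m, s m ≤ s' m) {t : ℝ} (ht : 0 ≤ t) : poissonAvg s t ≤ poissonAvg s' t :=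
  (poisson_summable hs t).tsum_le_tsum (fun m => mul_le_mul_of_nonneg_left (h m) (by positivity))
    (poisson_summable hs' t)

lemma poissonAvg_add {s s' : ℕ → ℝ} {B B' : ℝ} (hs : ∀ m, |s m| ≤ B) (hs' : ∀ m, |s' m| ≤ B')
    (t : ℝ) : poissonAvg (fun m => s m + s' m) t = poissonAvg s t + poissonAvg s' t := by
  unfold poissonAvg
  rw [← (poisson_summable hs t).tsum_add (poisson_summable hs' t)]
  simp only [mul_add]

lemma poissonAvg_integral {s : ℕ → ℝ} (h0 : ∀ m, 0 ≤ s m) (h1 : ∀ m, s m ≤ 1) {u : ℝ}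
    (hu : HasSum s u) :
    IntegrableOn (poissonAvg s) (Set.Ioi 0) ∧ ∫ t in Set.Ioi (0 : ℝ), poissonAvg s t = u := by
  have hI : ∀ m : ℕ, IntegrableOn
      (fun t : ℝ => (Real.exp (-t) * t ^ m / m.factorial) * s m) (Set.Ioi 0) := fun m =>
    ((gamma_integrable m).div_const _).mul_const _
  have hv : ∀ m : ℕ,
      ∫ t in Set.Ioi (0 : ℝ), (Real.exp (-t) * t ^ m / m.factorial) * s m = s m := by
    intro m
    rw [integral_mul_const, integral_div, gamma_integral, div_self (by positivity), one_mul]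
  have hpos : ∀ m : ℕ, ∀ t ∈ Set.Ioi (0 : ℝ),
      0 ≤ (Real.exp (-t) * t ^ m / m.factorial) * s m := fun m t ht => by
    have : 0 < t := ht
    have := h0 m
    positivity
  have hae : ∀ m : ℕ, 0 ≤ᵐ[volume.restrict (Set.Ioi (0 : ℝ))]
      fun t => (Real.exp (-t) * t ^ m / m.factorial) * s m := fun m =>
    (ae_restrict_iff' measurableSet_Ioi).2 (ae_of_all _ (hpos m))
  constructor
  · refine integrable_tsum_of_nonneg hI hae (by simpa only [hv] using hu.summable)
      (ae_of_all _ fun t => poisson_summable (B := 1) (fun m => ?_) t)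
    rw [abs_of_nonneg (h0 m)]; exact h1 m
  · have hn : ∀ m : ℕ, ∫ t in Set.Ioi (0 : ℝ),
        ‖(Real.exp (-t) * t ^ m / m.factorial) * s m‖ = s m := fun m => by
      refine Eq.trans ?_ (hv m)
      exact setIntegral_congr_fun measurableSet_Ioi fun t ht => Real.norm_of_nonneg (hpos m t ht)
    have := hasSum_integral_of_summable_integral_norm (μ := volume.restrict (Set.Ioi (0 : ℝ))) hI
      (by simpa only [hn] using hu.summable)
    simp only [hv] at this
    exact this.unique hu

lemma poissonAvg_integral_mul {s : ℕ → ℝ} (h0 : ∀ m, 0 ≤ s m) (h1 : ∀ m, s m ≤ 1) {u : ℝ}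
    (hu : HasSum (fun m : ℕ => ((m : ℝ) + 1) * s m) u) :
    IntegrableOn (fun t => t * poissonAvg s t) (Set.Ioi 0) ∧
      ∫ t in Set.Ioi (0 : ℝ), t * poissonAvg s t = u := by
  have heq : ∀ (m : ℕ) (t : ℝ), t * ((Real.exp (-t) * t ^ m / m.factorial) * s m) =
      (Real.exp (-t) * t ^ (m + 1) / m.factorial) * s m := fun m t => by ring
  have hI : ∀ m : ℕ, IntegrableOn
      (fun t : ℝ => t * ((Real.exp (-t) * t ^ m / m.factorial) * s m)) (Set.Ioi 0) := fun m => by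
    simp only [heq]
    exact ((gamma_integrable (m + 1)).div_const _).mul_const _
  have hv : ∀ m : ℕ, ∫ t in Set.Ioi (0 : ℝ),
      t * ((Real.exp (-t) * t ^ m / m.factorial) * s m) = (m + 1) * s m := by
    intro m
    simp only [heq]
    rw [integral_mul_const, integral_div, gamma_integral, Nat.factorial_succ]
    push_cast
    field_simp
  have hpos : ∀ m : ℕ, ∀ t ∈ Set.Ioi (0 : ℝ),
      0 ≤ t * ((Real.exp (-t) * t ^ m / m.factorial) * s m) := fun m t ht => by
    have : 0 < t := ht
    have := h0 m
    positivity
  have hae : ∀ m : ℕ, 0 ≤ᵐ[volume.restrict (Set.Ioi (0 : ℝ))]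
      fun t => t * ((Real.exp (-t) * t ^ m / m.factorial) * s m) := fun m =>
    (ae_restrict_iff' measurableSet_Ioi).2 (ae_of_all _ (hpos m))
  have ht : ∀ t, t * poissonAvg s t =
      ∑' m : ℕ, t * ((Real.exp (-t) * t ^ m / m.factorial) * s m) := fun t => by
    rw [poissonAvg, tsum_mul_left]
  simp only [ht]
  constructor
  · refine integrable_tsum_of_nonneg hI hae (by simpa only [hv] using hu.summable)
      (ae_of_all _ fun t => (poisson_summable (B := 1) (fun m => ?_) t).mul_left t)
    rw [abs_of_nonneg (h0 m)]; exact h1 m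
  · have hn : ∀ m : ℕ, ∫ t in Set.Ioi (0 : ℝ),
        ‖t * ((Real.exp (-t) * t ^ m / m.factorial) * s m)‖ = (m + 1) * s m := fun m => by
      refine Eq.trans ?_ (hv m)
      exact setIntegral_congr_fun measurableSet_Ioi fun t ht => Real.norm_of_nonneg (hpos m t ht)
    have := hasSum_integral_of_summable_integral_norm (μ := volume.restrict (Set.Ioi (0 : ℝ))) hI
      (by simpa only [hn] using hu.summable)
    simp only [hv] at this
    exact this.unique hu

lemma hasSum_succ_mul_of_hasSum_remainder {s : ℕ → ℝ} (h0 : ∀ m, 0 ≤ s m) {u w : ℝ}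
    (hu : HasSum s u) (hw : HasSum (fun N => u - ∑ m ∈ Finset.range N, s m) w) :
    HasSum (fun m : ℕ => ((m : ℝ) + 1) * s m) w := by
  have htail : ∀ N, HasSum (fun k => s (N + k)) (u - ∑ m ∈ Finset.range N, s m) := fun N => by
    have := (hasSum_nat_add_iff' N).2 hu
    simpa only [add_comm] using this
  have hsum : Summable fun p : ℕ × ℕ => s (p.1 + p.2) := by
    refine (summable_prod_of_nonneg fun p => h0 _).2 ⟨fun N => (htail N).summable, ?_⟩
    simpa only [(htail _).tsum_eq] using hw.summable
  have h1 : HasSum (fun p : ℕ × ℕ => s (p.1 + p.2)) w := by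
    have := hsum.hasSum.prod_fiberwise htail
    rw [← this.unique hw]
    exact hsum.hasSum
  have h2 := (Finset.HasAntidiagonal.sigmaAntidiagonalEquivProd (A := ℕ)).hasSum_iff.2 h1
  have h3 := h2.sigma (g := fun m : ℕ => ((m : ℝ) + 1) * s m) fun m => by
    have h4 := hasSum_fintype fun p : Finset.HasAntidiagonal.antidiagonal m => s (p.1.1 + p.1.2)
    have h5 : ∑ p : Finset.HasAntidiagonal.antidiagonal m, s (p.1.1 + p.1.2) = (m + 1) * s m := by
      rw [Finset.sum_coe_sort (Finset.HasAntidiagonal.antidiagonal m) fun p => s (p.1 + p.2),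
        Finset.sum_congr rfl fun p hp => by rw [Finset.HasAntidiagonal.mem_antidiagonal.1 hp]]
      simp
    rw [h5] at h4
    exact h4
  exact h3

namespace BDChain

variable {n : ℕ} (c : BDChain n)

lemma sum_K_mono_of_le {M x : Fin (n + 1)} (hx : x < M) {f g : Fin (n + 1) → ℝ}
    (h : ∀ y ≤ M, f y ≤ g y) : ∑ y, c.K x y * f y ≤ ∑ y, c.K x y * g y := by
  refine Finset.sum_le_sum fun y _ => ?_
  rcases le_or_gt y M with hy | hy
  · exact mul_le_mul_of_nonneg_left (h y hy) (c.K_nonneg _ _)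
  · rw [c.K_tridiag x y (by rw [lt_abs]; rw [Fin.lt_def] at hx hy; omega)]
    simp

lemma hasSum_iterates {M : Fin (n + 1)} {g : ℕ → Fin (n + 1) → ℝ} {U : ℕ → ℝ}
    (hgM : ∀ N, g N M = 0) (hgs : ∀ N, ∀ x < M, g (N + 1) x = ∑ y, c.K x y * g N y)
    (hg1 : ∀ x < M, 1 ≤ g 0 x) (hU : ∀ x, 0 ≤ U x) (hUM : U M = 0)
    (hUs : ∀ x < M, U x - c.avg U x = g 0 x) {x : Fin (n + 1)} (hx : x ≤ M) :
    HasSum (fun N => g N x) (U x) := by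
  have hrec : ∀ N, ∀ x < M, U x - ∑ m ∈ Finset.range (N + 1), g m x =
      ∑ y, c.K x y * (U y - ∑ m ∈ Finset.range N, g m y) := by
    intro N x hx
    simp only [mul_sub, Finset.sum_sub_distrib, Finset.mul_sum]
    rw [Finset.sum_comm, Finset.sum_range_succ', c.sum_K_eq_avg U x]
    simp only [← hgs _ x hx]
    linarith [hUs x hx]
  have hg0 : ∀ N, ∀ x ≤ M, 0 ≤ g N x := by
    intro N
    induction N with
    | zero =>
      intro x hx
      rcases hx.lt_or_eq with hx | rfl
      · linarith [hg1 x hx]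
      · rw [hgM]
    | succ N ih =>
      intro x hx
      rcases hx.lt_or_eq with hx | rfl
      · rw [hgs N x hx]
        have := c.sum_K_mono_of_le hx (f := fun _ => 0) ih
        simpa using this
      · rw [hgM]
  set C := ∑ y ∈ Finset.range (n + 1), U y
  have hC0 : 0 ≤ C := Finset.sum_nonneg fun y _ => hU y
  have hR : ∀ N, ∀ x ≤ M, 0 ≤ U x - ∑ m ∈ Finset.range N, g m x ∧
      U x - ∑ m ∈ Finset.range N, g m x ≤ C * g N x := by
    intro N
    induction N with
    | zero =>
      intro x hx
      rcases hx.lt_or_eq with hx | rfl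
      · have : U x ≤ C := Finset.single_le_sum (fun y _ => hU y) (Finset.mem_range.2 x.2)
        simp only [Finset.range_zero, Finset.sum_empty, sub_zero]
        exact ⟨hU x, by nlinarith [hg1 x hx]⟩
      · simp [hUM, hgM]
    | succ N ih =>
      intro x hx
      rcases hx.lt_or_eq with hx | rfl
      · rw [hrec N x hx]
        constructor
        · have := c.sum_K_mono_of_le hx (f := fun _ => 0) fun y hy => (ih y hy).1
          simpa using this
        · refine (c.sum_K_mono_of_le hx fun y hy => (ih y hy).2).trans (le_of_eq ?_)
          rw [hgs N x hx, Finset.mul_sum]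
          exact Finset.sum_congr rfl fun y _ => by ring
      · simp [hUM, hgM]
  have hsummable : Summable fun N => g N x :=
    summable_of_sum_range_le (c := U x) (fun N => hg0 N x hx) fun N => by linarith [(hR N x hx).1]
  have hlim : Tendsto (fun N => U x - ∑ m ∈ Finset.range N, g m x) atTop (nhds 0) := by
    refine squeeze_zero (fun N => (hR N x hx).1) (fun N => (hR N x hx).2) ?_
    simpa using hsummable.tendsto_atTop_zero.const_mul C
  rw [hsummable.hasSum_iff_tendsto_nat]
  simpa using hlim.const_sub (U x)

lemma hasSum_hitSurv {M x : Fin (n + 1)} (hx : x ≤ M) :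
    HasSum (c.hitSurv M x) (c.poissonSol (fun _ => 1) M x) := by
  refine c.hasSum_iterates (g := fun N x => c.hitSurv M x N) (fun N => c.hitSurv_self M N)
    (fun N x hx => ?_) (fun x hx => ?_) (fun x => c.poissonSol_nonneg (by simp) M x)
    (c.poissonSol_self _ _) (fun x hx => ?_) hx
  · simp only [c.hitSurv_succ, if_neg hx.ne]
  · simp only [c.hitSurv_zero, if_neg hx.ne]; rfl
  · simp only [c.hitSurv_zero, if_neg hx.ne]
    exact c.poissonSol_eq _ (Nat.lt_succ_iff.1 M.2) hx

lemma hasSum_succ_mul_hitSurv {M x : Fin (n + 1)} (hx : x ≤ M) :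
    HasSum (fun m : ℕ => ((m : ℝ) + 1) * c.hitSurv M x m)
      (c.poissonSol (c.poissonSol (fun _ => 1) M) M x) := by
  refine hasSum_succ_mul_of_hasSum_remainder (fun m => c.hitSurv_nonneg M x m)
    (c.hasSum_hitSurv hx) ?_
  have hU := fun x => c.poissonSol_nonneg (g := fun _ => 1) (by simp) M x
  refine c.hasSum_iterates (g := fun N x => c.poissonSol (fun _ => 1) M x -
    ∑ m ∈ Finset.range N, c.hitSurv M x m) (fun N => ?_)
    (fun N x hx => ?_) (fun x hx => ?_) (fun x => c.poissonSol_nonneg hU M x)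
    (c.poissonSol_self _ _) (fun x hx => ?_) hx
  · simp [poissonSol_self, hitSurv_self]
  · simp only [mul_sub, Finset.sum_sub_distrib, Finset.mul_sum]
    rw [Finset.sum_comm, Finset.sum_range_succ', c.sum_K_eq_avg _ x, c.hitSurv_zero, if_neg hx.ne]
    have h2 : ∀ m, c.hitSurv M x (m + 1) = ∑ y, c.K x y * c.hitSurv M y m := fun m => by
      rw [c.hitSurv_succ, if_neg hx.ne]
    simp only [h2]
    have := c.poissonSol_eq (fun _ => 1) (Nat.lt_succ_iff.1 M.2) (Fin.lt_def.1 hx)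
    linarith
  · have := (c.hasSum_hitSurv hx.le).summable.sum_le_tsum {0} fun m _ => c.hitSurv_nonneg M x m
    rw [(c.hasSum_hitSurv hx.le).tsum_eq] at this
    simpa [c.hitSurv_zero, if_neg hx.ne] using this
  · simp only [Finset.range_zero, Finset.sum_empty, sub_zero]
    exact c.poissonSol_eq _ (Nat.lt_succ_iff.1 M.2) hx

lemma hitSurvC_eq (i j : Fin (n + 1)) : c.hitSurvC i j = poissonAvg (c.hitSurv i j) := rfl

lemma integrableOn_hitSurvC {M x : Fin (n + 1)} (hx : x ≤ M) :
    IntegrableOn (c.hitSurvC M x) (Set.Ioi 0) :=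
  (poissonAvg_integral (c.hitSurv_nonneg M x) (c.hitSurv_le_one M x) (c.hasSum_hitSurv hx)).1

lemma integrableOn_mul_hitSurvC {M x : Fin (n + 1)} (hx : x ≤ M) :
    IntegrableOn (fun t => t * c.hitSurvC M x t) (Set.Ioi 0) :=
  (poissonAvg_integral_mul (c.hitSurv_nonneg M x) (c.hitSurv_le_one M x)
    (c.hasSum_succ_mul_hitSurv hx)).1

lemma poissonSol_const_mul (a : ℝ) (g : ℕ → ℝ) (M x : ℕ) :
    c.poissonSol (fun y => a * g y) M x = a * c.poissonSol g M x := by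
  rw [poissonSol, poissonSol, Finset.mul_sum]
  refine Finset.sum_congr rfl fun z _ => ?_
  rw [← mul_div_assoc, Finset.mul_sum]
  congr 1
  exact Finset.sum_congr rfl fun y _ => by ring

lemma hitMeanC_zero (M : Fin (n + 1)) : c.hitMeanC M 0 = c.climbMean M := by
  rw [← c.poissonSol_one_zero]
  exact (poissonAvg_integral (c.hitSurv_nonneg M 0) (c.hitSurv_le_one M 0)
    (c.hasSum_hitSurv (Fin.zero_le M))).2

lemma hitVarC_zero (M : Fin (n + 1)) : c.hitVarC M 0 = c.climbVar M := by
  rw [← c.poissonSol_second, hitVarC, hitMeanC_zero]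
  congr 1
  simp only [mul_assoc]
  rw [integral_const_mul, c.hitSurvC_eq, (poissonAvg_integral_mul (c.hitSurv_nonneg M 0)
    (c.hitSurv_le_one M 0) (c.hasSum_succ_mul_hitSurv (Fin.zero_le M))).2]
  exact (c.poissonSol_const_mul 2 _ _ _).symm

lemma hitMeanC_last (M : Fin (n + 1)) :
    c.hitMeanC M (Fin.last n) = c.rev.climbMean (n - M) := by
  have := c.rev.hitMeanC_zero M.rev
  rw [rev_hitMeanC, Fin.rev_rev, Fin.rev_zero, Fin.val_rev] at this
  rw [this]; congr 1; omega

lemma hitVarC_last (M : Fin (n + 1)) :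
    c.hitVarC M (Fin.last n) = c.rev.climbVar (n - M) := by
  have := c.rev.hitVarC_zero M.rev
  rw [rev_hitVarC, Fin.rev_rev, Fin.rev_zero, Fin.val_rev] at this
  rw [this]; congr 1; omega

end BDChain

lemma poisson_weight_summable (t : ℝ) :
    Summable fun m : ℕ => Real.exp (-t) * t ^ m / (m.factorial : ℝ) := by
  simpa using poisson_summable (s := fun _ => 1) (B := 1) (by simp) t

lemma poisson_weight_tsum (t : ℝ) :
    ∑' m : ℕ, Real.exp (-t) * t ^ m / (m.factorial : ℝ) = 1 := by
  simpa [poissonAvg] using poissonAvg_const 1 t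

lemma cast_choose_mul_factorial {i j m : ℕ} (h : i + j = m) :
    ((m.choose i : ℕ) : ℝ) * i.factorial * j.factorial = m.factorial := by
  rw [← h, Nat.choose_symm_add]
  exact_mod_cast Nat.add_choose_mul_factorial_mul_factorial i j

lemma sum_antidiagonal_poisson_weight (t h : ℝ) (m : ℕ) :
    ∑ p ∈ Finset.HasAntidiagonal.antidiagonal m,
      (Real.exp (-t) * t ^ p.1 / (p.1.factorial : ℝ)) *
        (Real.exp (-h) * h ^ p.2 / (p.2.factorial : ℝ)) =
      Real.exp (-(t + h)) * (t + h) ^ m / (m.factorial : ℝ) := by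
  rw [(Commute.all t h).add_pow', neg_add, Real.exp_add, Finset.mul_sum, Finset.sum_div]
  refine Finset.sum_congr rfl fun p hp => ?_
  have hp' := Finset.HasAntidiagonal.mem_antidiagonal.1 hp
  have h1 := cast_choose_mul_factorial hp'
  have h2 : (p.1.factorial : ℝ) ≠ 0 := by positivity
  have h3 : (p.2.factorial : ℝ) ≠ 0 := by positivity
  have h4 : (m.factorial : ℝ) ≠ 0 := by positivity
  rw [nsmul_eq_mul]
  field_simp
  linear_combination (-(t ^ p.1 * h ^ p.2)) * h1

lemma poissonAvg_anti {s : ℕ → ℝ} (h0 : ∀ m, 0 ≤ s m) (h1 : ∀ m, s m ≤ 1) (hs : Antitone s)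
    {t t' : ℝ} (ht : 0 ≤ t) (htt : t ≤ t') : poissonAvg s t' ≤ poissonAvg s t := by
  obtain ⟨h, rfl⟩ : ∃ h, t' = t + h := ⟨t' - t, by ring⟩
  have hh : 0 ≤ h := by linarith
  set w := fun (t : ℝ) (m : ℕ) => Real.exp (-t) * t ^ m / (m.factorial : ℝ) with hw
  have hw0 : ∀ m, 0 ≤ w t m := fun m => by positivity
  have hw0' : ∀ m, 0 ≤ w h m := fun m => by positivity
  have hww : Summable fun p : ℕ × ℕ => w t p.1 * w h p.2 :=
    (poisson_weight_summable t).mul_of_nonneg (poisson_weight_summable h) hw0 hw0'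
  have hS1 : Summable fun p : ℕ × ℕ => w t p.1 * w h p.2 * s (p.1 + p.2) :=
    Summable.of_nonneg_of_le (fun p => mul_nonneg (mul_nonneg (hw0 _) (hw0' _)) (h0 _))
      (fun p => mul_le_of_le_one_right (mul_nonneg (hw0 _) (hw0' _)) (h1 _)) hww
  have hS2 : Summable fun p : ℕ × ℕ => w t p.1 * w h p.2 * s p.1 :=
    Summable.of_nonneg_of_le (fun p => mul_nonneg (mul_nonneg (hw0 _) (hw0' _)) (h0 _))
      (fun p => mul_le_of_le_one_right (mul_nonneg (hw0 _) (hw0' _)) (h1 _)) hww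
  have e2 : ∑' p : ℕ × ℕ, w t p.1 * w h p.2 * s p.1 = poissonAvg s t := by
    rw [hS2.tsum_prod]
    refine tsum_congr fun m => ?_
    simp only [mul_right_comm _ _ (s m)]
    rw [tsum_mul_left, poisson_weight_tsum, mul_one]
  have e1 : HasSum (fun m => w (t + h) m * s m)
      (∑' p : ℕ × ℕ, w t p.1 * w h p.2 * s (p.1 + p.2)) := by
    have h2 := (Finset.HasAntidiagonal.sigmaAntidiagonalEquivProd (A := ℕ)).hasSum_iff.2 hS1.hasSum
    refine h2.sigma fun m => ?_
    have h4 := hasSum_fintype fun p : Finset.HasAntidiagonal.antidiagonal m =>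
      w t p.1.1 * w h p.1.2 * s (p.1.1 + p.1.2)
    have h5 : ∑ p : Finset.HasAntidiagonal.antidiagonal m,
        w t p.1.1 * w h p.1.2 * s (p.1.1 + p.1.2) = w (t + h) m * s m := by
      rw [Finset.sum_coe_sort (Finset.HasAntidiagonal.antidiagonal m)
          fun p => w t p.1 * w h p.2 * s (p.1 + p.2),
        Finset.sum_congr rfl fun p hp => by rw [Finset.HasAntidiagonal.mem_antidiagonal.1 hp],
        ← Finset.sum_mul]
      congr 1
      exact sum_antidiagonal_poisson_weight t h m
    rw [h5] at h4
    exact h4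
  rw [poissonAvg, e1.tsum_eq, ← e2]
  exact hS1.tsum_le_tsum (fun p => mul_le_mul_of_nonneg_left (hs (Nat.le_add_right _ _))
    (mul_nonneg (hw0 _) (hw0' _))) hS2

lemma poissonAvg_thinning {ι : Type*} [Fintype ι] [DecidableEq ι] (A : Matrix ι ι ℝ) (v : ι → ℝ)
    (x : ι) {B : ℝ} (hB : ∀ j : ℕ, |((A ^ j) *ᵥ v) x| ≤ B) (t : ℝ) :
    poissonAvg (fun m => ((((3 / 4 : ℝ) • (1 : Matrix ι ι ℝ) + (1 / 4 : ℝ) • A) ^ m) *ᵥ v) x)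
      (4 * t) = poissonAvg (fun j => ((A ^ j) *ᵥ v) x) t := by
  have hs := poisson_summable hB t
  have h1 := (poisson_weight_summable (3 * t)).norm
  have key := tsum_mul_tsum_eq_tsum_sum_antidiagonal_of_summable_norm h1 hs.norm
  rw [poisson_weight_tsum, one_mul] at key
  unfold poissonAvg
  rw [key]
  refine tsum_congr fun m => ?_
  have hc : Commute ((3 / 4 : ℝ) • (1 : Matrix ι ι ℝ)) ((1 / 4 : ℝ) • A) :=
    ((Commute.one_left A).smul_left _).smul_right _
  beta_reduce
  rw [hc.add_pow', Matrix.sum_mulVec, Finset.sum_apply, Finset.mul_sum]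
  refine Finset.sum_congr rfl fun p hp => ?_
  have hp' := Finset.HasAntidiagonal.mem_antidiagonal.1 hp
  have h1 := cast_choose_mul_factorial hp'
  have h2 : (p.1.factorial : ℝ) ≠ 0 := by positivity
  have h3 : (p.2.factorial : ℝ) ≠ 0 := by positivity
  have h4 : (m.factorial : ℝ) ≠ 0 := by positivity
  have he : Real.exp (-(4 * t)) = Real.exp (-(3 * t)) * Real.exp (-t) := by
    rw [← Real.exp_add]; ring_nf
  rw [_root_.smul_pow, _root_.smul_pow, one_pow, smul_mul_smul_comm, one_mul, ← Nat.cast_smul_eq_nsmul ℝ,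
    smul_smul, Matrix.smul_mulVec, Pi.smul_apply, smul_eq_mul, he]
  have h5 : (4 * t) ^ m = 4 ^ p.1 * 4 ^ p.2 * t ^ p.1 * t ^ p.2 := by
    rw [← hp', pow_add, mul_pow, mul_pow]; ring
  rw [h5, mul_pow, div_pow, div_pow, one_pow, ← h1]
  have h6 : ((m.choose p.1 : ℕ) : ℝ) ≠ 0 := by
    rintro h0
    rw [h0] at h1
    simp at h1
    exact h4 h1.symm
  field_simp

/-- One-sided Chebyshev comparison for a survival function: `S` is bounded by `1` before `a`, and
compared with the constant `σ` between `a` and `b`. -/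
lemma integral_survival_ge {S : ℝ → ℝ} {E a b σ : ℝ} (ha : 0 ≤ a) (hab : a ≤ b)
    (hS : IntegrableOn S (Set.Ioi 0)) (htS : IntegrableOn (fun t => t * S t) (Set.Ioi 0))
    (h1 : ∀ s, 0 ≤ s → s ≤ a → s - E ≤ (s - E) * S s)
    (h2 : ∀ s, a ≤ s → s ≤ b → (s - E) * σ ≤ (s - E) * S s)
    (h3 : ∀ s, b ≤ s → 0 ≤ (s - E) * S s) :
    (a - E) ^ 2 - E ^ 2 + σ * ((b - E) ^ 2 - (a - E) ^ 2) ≤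
      (∫ t in Set.Ioi (0 : ℝ), 2 * t * S t) - 2 * E * ∫ t in Set.Ioi (0 : ℝ), S t := by
  have hf : IntegrableOn (fun t => (t - E) * S t) (Set.Ioi 0) := by
    simp only [sub_mul]
    exact htS.sub (hS.const_mul E)
  have e0 : (∫ t in Set.Ioi (0 : ℝ), 2 * t * S t) - 2 * E * ∫ t in Set.Ioi (0 : ℝ), S t =
      2 * ∫ t in Set.Ioi (0 : ℝ), (t - E) * S t := by
    simp only [sub_mul, mul_assoc]
    rw [integral_sub htS (hS.const_mul E), integral_const_mul, integral_const_mul]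
    ring
  have hfa : IntegrableOn (fun t => (t - E) * S t) (Set.Ioi a) :=
    hf.mono_set (Set.Ioi_subset_Ioi ha)
  have hfb : IntegrableOn (fun t => (t - E) * S t) (Set.Ioi b) :=
    hf.mono_set (Set.Ioi_subset_Ioi (ha.trans hab))
  have i1 : IntervalIntegrable (fun t => (t - E) * S t) volume 0 a :=
    (intervalIntegrable_iff_integrableOn_Ioc_of_le ha).2 (hf.mono_set Set.Ioc_subset_Ioi_self)
  have i2 : IntervalIntegrable (fun t => (t - E) * S t) volume a b :=
    (intervalIntegrable_iff_integrableOn_Ioc_of_le hab).2 (hfa.mono_set Set.Ioc_subset_Ioi_self)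
  have hp : ∀ u v : ℝ, ∫ t in u..v, (t - E) = ((v - E) ^ 2 - (u - E) ^ 2) / 2 := by
    intro u v
    rw [intervalIntegral.integral_sub (by simp) (by simp)]
    simp only [integral_id, intervalIntegral.integral_const, smul_eq_mul]
    ring
  rw [e0, ← intervalIntegral.integral_interval_add_Ioi hf hfa,
    ← intervalIntegral.integral_interval_add_Ioi hfa hfb]
  have j1 : ∫ t in (0 : ℝ)..a, (t - E) ≤ ∫ t in (0 : ℝ)..a, (t - E) * S t :=
    intervalIntegral.integral_mono_on ha (Continuous.intervalIntegrable (by fun_prop) _ _) i1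
      fun s hs => h1 s hs.1 hs.2
  have j2 : ∫ t in a..b, (t - E) * σ ≤ ∫ t in a..b, (t - E) * S t :=
    intervalIntegral.integral_mono_on hab (Continuous.intervalIntegrable (by fun_prop) _ _) i2
      fun s hs => h2 s hs.1 hs.2
  have j3 : 0 ≤ ∫ t in Set.Ioi b, (t - E) * S t :=
    setIntegral_nonneg measurableSet_Ioi fun s hs => h3 s (le_of_lt hs)
  rw [intervalIntegral.integral_mul_const, hp] at j2
  rw [hp] at j1
  nlinarith

namespace BDChain

variable {n : ℕ} (c : BDChain n)

lemma hitSurv_anti (i j : Fin (n + 1)) : Antitone (c.hitSurv i j) := by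
  refine antitone_nat_of_succ_le fun m => ?_
  induction m generalizing j with
  | zero =>
    rw [hitSurv_zero]
    split_ifs with h
    · rw [h, hitSurv_self]
    · exact c.hitSurv_le_one _ _ _
  | succ m ih =>
    rw [hitSurv_succ, hitSurv_succ]
    split_ifs
    · exact le_rfl
    · exact Finset.sum_le_sum fun y _ => mul_le_mul_of_nonneg_left (ih y) (c.K_nonneg _ _)

lemma hitSurv_abs_le (i j : Fin (n + 1)) (m : ℕ) : |c.hitSurv i j m| ≤ 1 := by
  rw [abs_of_nonneg (c.hitSurv_nonneg i j m)]; exact c.hitSurv_le_one i j m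

lemma hitSurvC_nonneg (i j : Fin (n + 1)) {t : ℝ} (ht : 0 ≤ t) : 0 ≤ c.hitSurvC i j t :=
  tsum_nonneg fun m => mul_nonneg (by positivity) (c.hitSurv_nonneg i j m)

lemma hitSurvC_le_one (i j : Fin (n + 1)) {t : ℝ} (ht : 0 ≤ t) : c.hitSurvC i j t ≤ 1 := by
  rw [← poissonAvg_const 1 t]
  exact poissonAvg_mono (c.hitSurv_abs_le i j) (B' := 1) (by simp) (c.hitSurv_le_one i j) ht

lemma hitSurvC_anti (i j : Fin (n + 1)) {t t' : ℝ} (ht : 0 ≤ t) (h : t ≤ t') :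
    c.hitSurvC i j t' ≤ c.hitSurvC i j t :=
  poissonAvg_anti (c.hitSurv_nonneg i j) (c.hitSurv_le_one i j) (c.hitSurv_anti i j) ht h

/-- Chebyshev's inequality for the upper tail of a hitting time. -/
lemma hitSurvC_mul_sq_le {M x : Fin (n + 1)} (hx : x ≤ M) {t : ℝ} (h0 : 0 ≤ c.hitMeanC M x)
    (ht : c.hitMeanC M x ≤ t) :
    c.hitSurvC M x t * (t - c.hitMeanC M x) ^ 2 ≤ c.hitVarC M x := by
  have := integral_survival_ge (S := c.hitSurvC M x) (E := c.hitMeanC M x)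
    (σ := c.hitSurvC M x t) h0 ht (c.integrableOn_hitSurvC hx) (c.integrableOn_mul_hitSurvC hx)
    (fun s hs hsE => by nlinarith [c.hitSurvC_le_one M x hs])
    (fun s hs hst => mul_le_mul_of_nonneg_left (c.hitSurvC_anti M x (h0.trans hs) hst)
      (by linarith))
    (fun s hs => mul_nonneg (by linarith) (c.hitSurvC_nonneg M x (h0.trans (ht.trans hs))))
  rw [hitVarC]
  change _ ≤ (∫ t in Set.Ioi (0 : ℝ), 2 * t * c.hitSurvC M x t) -
    2 * c.hitMeanC M x * c.hitMeanC M x at this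
  nlinarith

/-- Chebyshev's inequality for the lower tail of a hitting time. -/
lemma one_sub_hitSurvC_mul_sq_le {M x : Fin (n + 1)} (hx : x ≤ M) {t : ℝ} (h0 : 0 ≤ t)
    (ht : t ≤ c.hitMeanC M x) :
    (1 - c.hitSurvC M x t) * (t - c.hitMeanC M x) ^ 2 ≤ c.hitVarC M x := by
  have := integral_survival_ge (S := c.hitSurvC M x) (E := c.hitMeanC M x)
    (σ := c.hitSurvC M x t) h0 ht (c.integrableOn_hitSurvC hx) (c.integrableOn_mul_hitSurvC hx)
    (fun s hs hsE => by nlinarith [c.hitSurvC_le_one M x hs])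
    (fun s hs hst => by nlinarith [c.hitSurvC_anti M x h0 hs])
    (fun s hs => mul_nonneg (by linarith) (c.hitSurvC_nonneg M x (h0.trans (ht.trans hs))))
  rw [hitVarC]
  change _ ≤ (∫ t in Set.Ioi (0 : ℝ), 2 * t * c.hitSurvC M x t) -
    2 * c.hitMeanC M x * c.hitMeanC M x at this
  nlinarith

end BDChain

/-- `d` is nonnegative before the index `k` and nonpositive from `k` on. -/
def SignChangeAt (d : ℕ → ℝ) (k : ℕ) : Prop := (∀ i < k, 0 ≤ d i) ∧ ∀ i, k ≤ i → d i ≤ 0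

lemma signChange_step {d d' a b e : ℕ → ℝ} (h0 : d' 0 = a 0 * d 0 + b 0 * d 1)
    (hs : ∀ i, d' (i + 1) = a (i + 1) * d (i + 1) + b (i + 1) * d (i + 2) + e (i + 1) * d i)
    (ha : ∀ i, 1 / 2 ≤ a i) (hb : ∀ i, 0 ≤ b i ∧ b i ≤ 1 / 4) (he : ∀ i, 0 ≤ e i ∧ e i ≤ 1 / 4)
    {k : ℕ} (h : SignChangeAt d k) : ∃ k', SignChangeAt d' k' ∧ (k = 0 → k' = 0) := by
  have hneg : ∀ i, k < i → d' i ≤ 0 := by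
    intro i hi
    obtain ⟨j, rfl⟩ : ∃ j, i = j + 1 := ⟨i - 1, by omega⟩
    rw [hs]
    have h1 := h.2 (j + 1) (by omega)
    have h2 := h.2 (j + 2) (by omega)
    have h3 := h.2 j (by omega)
    nlinarith [ha (j + 1), hb (j + 1), he (j + 1)]
  have hpos : ∀ i, i + 1 < k → 0 ≤ d' i := by
    intro i hi
    have h1 := h.1 i (by omega)
    have h2 := h.1 (i + 1) (by omega)
    rcases i with _ | j
    · rw [h0]
      nlinarith [ha 0, hb 0]
    · rw [hs]
      have h3 := h.1 j (by omega)
      nlinarith [ha (j + 1), hb (j + 1), he (j + 1)]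
  rcases k with _ | k
  · refine ⟨0, ⟨fun i hi => by omega, fun i _ => ?_⟩, fun _ => rfl⟩
    rcases Nat.eq_zero_or_pos i with rfl | hi
    · rw [h0]
      nlinarith [ha 0, hb 0, h.2 0 le_rfl, h.2 1 (by omega)]
    · exact hneg i hi
  by_cases h1 : 0 ≤ d' k
  · by_cases h2 : 0 ≤ d' (k + 1)
    · refine ⟨k + 2, ⟨fun i hi => ?_, fun i hi => hneg i (by omega)⟩, by simp⟩
      rcases (show i < k ∨ i = k ∨ i = k + 1 by omega) with hi | rfl | rfl
      · exact hpos i (by omega)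
      · exact h1
      · exact h2
    · refine ⟨k + 1, ⟨fun i hi => ?_, fun i hi => ?_⟩, by simp⟩
      · rcases (show i < k ∨ i = k by omega) with hi | rfl
        · exact hpos i (by omega)
        · exact h1
      · rcases (show i = k + 1 ∨ k + 1 < i by omega) with rfl | hi
        · linarith
        · exact hneg i hi
  · refine ⟨k, ⟨fun i hi => hpos i (by omega), fun i hi => ?_⟩, by simp⟩
    rcases (show i = k ∨ i = k + 1 ∨ k + 1 < i by omega) with rfl | rfl | hi
    · linarith
    · push Not at h1
      have p1 := h.1 k (by omega)
      have p2 := h.2 (k + 1) le_rfl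
      have p3 := h.2 (k + 2) (by omega)
      have q1 : a k * d k + b k * d (k + 1) ≤ d' k := by
        rcases k with _ | j
        · rw [h0]
        · rw [hs]
          have := mul_nonneg (he (j + 1)).1 (h.1 j (by omega))
          linarith
      have q2 : d' (k + 1) ≤ a (k + 1) * d (k + 1) + e (k + 1) * d k := by
        rw [hs]
        have := mul_nonpos_of_nonneg_of_nonpos (hb (k + 1)).1 p3
        linarith
      nlinarith [ha k, hb k, ha (k + 1), he (k + 1)]
    · exact hneg i hi

namespace BDChain

variable {n : ℕ} (c : BDChain n)

/-- The increments of `f` on `[0, n]`. -/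
def incr (n : ℕ) (f : ℕ → ℝ) (i : ℕ) : ℝ := if i < n then f (i + 1) - f i else 0

lemma incr_of_lt {f : ℕ → ℝ} {i : ℕ} (h : i < n) : incr n f i = f (i + 1) - f i := if_pos h

lemma incr_of_ge {f : ℕ → ℝ} {i : ℕ} (h : n ≤ i) : incr n f i = 0 := if_neg (by omega)

/-- The holding probability of the chain is large enough for the kernel to preserve unimodality. -/
def Sluggish : Prop := ∀ i j, i ≠ j → c.ker i j ≤ 1 / 4

variable {c}

lemma Sluggish.avg_signChange (hc : c.Sluggish) {f : ℕ → ℝ} {k : ℕ}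
    (h : SignChangeAt (incr n f) k) :
    ∃ k', SignChangeAt (incr n (c.avg f)) k' ∧ (k = 0 → k' = 0) := by
  refine signChange_step (d := incr n f)
    (a := fun i => if i < n then 1 - c.ker i (i + 1) - c.ker (i + 1) i else 1)
    (b := fun i => if i < n then c.ker (i + 1) (i + 2) else 0)
    (e := fun i => if i < n then c.ker i (i - 1) * (if i = 0 then 0 else 1) else 0)
    ?_ (fun i => ?_) (fun i => ?_) (fun i => ?_) (fun i => ?_) h
  · by_cases h0 : 0 < n
    · simp only [h0, if_true, incr_of_lt]
      have h1 := c.row_zero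
      have h2 := c.row_succ h0
      rw [show (0 : ℕ) + 1 = 1 from rfl, avg_zero, show (1 : ℕ) = 0 + 1 from rfl, avg_succ]
      by_cases h3 : 1 < n
      · rw [incr_of_lt h3]
        simp only [zero_add] at *
        linear_combination f 0 * (-h1) + f 1 * h2
      · rw [incr_of_ge (by omega)]
        have h4 := c.ker_of_gt_right (j := 2) (by omega) 1
        simp only [zero_add] at *
        rw [h4] at h2 ⊢
        linear_combination f 0 * (-h1) + f 1 * h2
    · simp [incr_of_ge (show n ≤ 0 by omega), incr_of_ge (show n ≤ 1 by omega)]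
  · by_cases h0 : i + 1 < n
    · have h1 := c.row_succ (k := i) (by omega)
      have h2 := c.row_succ h0
      simp only [h0, if_true]
      rw [incr_of_lt h0, incr_of_lt h0, incr_of_lt (show i < n by omega), avg_succ, avg_succ]
      simp only [add_assoc, Nat.reduceAdd, Nat.add_sub_cancel, Nat.add_eq_zero_iff, one_ne_zero,
        and_false, if_false, mul_one] at *
      by_cases h3 : i + 2 < n
      · rw [incr_of_lt h3]
        simp only [add_assoc, Nat.reduceAdd]
        linear_combination f (i + 1) * (-h1) + f (i + 2) * h2
      · rw [incr_of_ge (by omega)]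
        have h4 := c.ker_of_gt_right (j := i + 3) (by omega) (i + 2)
        rw [h4] at h2 ⊢
        linear_combination f (i + 1) * (-h1) + f (i + 2) * h2
    · simp [incr_of_ge (show n ≤ i + 1 by omega), h0]
  · split_ifs
    · linarith [hc i (i + 1) (by omega), hc (i + 1) i (by omega)]
    · norm_num
  · split_ifs
    · exact ⟨c.ker_nonneg _ _, hc _ _ (by omega)⟩
    · norm_num
  · split_ifs
    · norm_num
    · rw [mul_one]; exact ⟨c.ker_nonneg _ _, hc _ _ (by omega)⟩
    · norm_num

lemma Sluggish.iterate_signChange (hc : c.Sluggish) {f : ℕ → ℝ} {k : ℕ}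
    (h : SignChangeAt (incr n f) k) (m : ℕ) :
    ∃ k', SignChangeAt (incr n (c.avg^[m] f)) k' ∧ (k = 0 → k' = 0) := by
  induction m with
  | zero => exact ⟨k, h, fun h => h⟩
  | succ m ih =>
    obtain ⟨k', h1, h2⟩ := ih
    obtain ⟨k'', h3, h4⟩ := hc.avg_signChange h1
    exact ⟨k'', by rwa [Function.iterate_succ_apply'], fun h => h4 (h2 h)⟩

lemma le_of_incr_nonpos {f : ℕ → ℝ} {a b k : ℕ} (h : ∀ i, k ≤ i → incr n f i ≤ 0) (hk : k ≤ a)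
    (hab : a ≤ b) (hb : b ≤ n) : f b ≤ f a := by
  induction b, hab using Nat.le_induction with
  | base => exact le_rfl
  | succ b hab ih =>
    have := h b (by omega)
    rw [incr_of_lt (by omega)] at this
    linarith [ih (by omega)]

lemma Sluggish.iterate_anti (hc : c.Sluggish) {f : ℕ → ℝ}
    (h : ∀ i < n, f (i + 1) ≤ f i) (m : ℕ) {a b : ℕ} (hab : a ≤ b) (hb : b ≤ n) :
    c.avg^[m] f b ≤ c.avg^[m] f a := by
  have h0 : SignChangeAt (incr n f) 0 := ⟨fun i hi => by omega, fun i _ => by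
    unfold incr
    split_ifs with hi
    · linarith [h i hi]
    · exact le_rfl⟩
  obtain ⟨k, h1, h2⟩ := hc.iterate_signChange h0 m
  rw [h2 rfl] at h1
  exact le_of_incr_nonpos h1.2 (Nat.zero_le _) hab hb

variable (c)

lemma pow_mulVec_eq_iterate (f : ℕ → ℝ) (m : ℕ) (x : Fin (n + 1)) :
    ((c.K ^ m) *ᵥ fun y : Fin (n + 1) => f y) x = c.avg^[m] f x := by
  induction m generalizing x with
  | zero => simp
  | succ m ih =>
    rw [pow_succ', ← Matrix.mulVec_mulVec, Function.iterate_succ_apply', ← sum_K_eq_avg]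
    simp only [Matrix.mulVec, dotProduct] at *
    exact Finset.sum_congr rfl fun y _ => by rw [ih]

lemma iterate_avg_nonneg {f : ℕ → ℝ} (hf : ∀ i, 0 ≤ f i) (m i : ℕ) : 0 ≤ c.avg^[m] f i := by
  induction m generalizing i with
  | zero => exact hf i
  | succ m ih =>
    rw [Function.iterate_succ_apply']
    exact Finset.sum_nonneg fun j _ => mul_nonneg (c.ker_nonneg _ _) (ih j)

lemma sum_wt_iterate_avg (f : ℕ → ℝ) (m : ℕ) :
    ∑ y ∈ Finset.range (n + 1), c.wt y * c.avg^[m] f y =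
      ∑ y ∈ Finset.range (n + 1), c.wt y * f y := by
  induction m with
  | zero => rfl
  | succ m ih => rw [Function.iterate_succ_apply', sum_wt_avg, ih]

variable {c}

lemma Sluggish.iterate_le_hitSurv (hc : c.Sluggish) {f : ℕ → ℝ} (hf0 : ∀ i, 0 ≤ f i)
    (hf1 : ∀ i, f i ≤ 1) (hf : ∀ i < n, f (i + 1) ≤ f i) {M : Fin (n + 1)} {δ : ℝ} (hδ : δ < 1)
    (hM : 1 - δ ≤ c.piLow M) (m : ℕ) (x : Fin (n + 1)) :
    c.avg^[m] f x ≤ c.hitSurv M 0 m + δ / (1 - δ) +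
      ∑ y ∈ Finset.range (n + 1), c.wt y * f y := by
  set π := ∑ y ∈ Finset.range (n + 1), c.wt y * f y with hπ
  have hMn : (M : ℕ) ≤ n := Nat.lt_succ_iff.1 M.2
  have hπ1 : π ≤ 1 := by
    rw [← c.sum_wt]
    exact Finset.sum_le_sum fun y _ => mul_le_of_le_one_right (c.wt_nonneg y) (hf1 y)
  have hcum1 : c.piLow M ≤ 1 := by
    rw [← c.cum_eq_piLow, ← c.cum_top]
    exact c.cum_mono hMn
  have hδ0 : 0 ≤ δ := by linarith
  have hCM : ∀ k, c.avg^[k] f M ≤ δ / (1 - δ) + π := by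
    intro k
    have h1 : c.avg^[k] f M * c.cum M ≤ π := by
      rw [hπ, ← c.sum_wt_iterate_avg f k, cum, Finset.mul_sum]
      refine (Finset.sum_le_sum fun y hy => ?_).trans (Finset.sum_le_sum_of_subset_of_nonneg
        (Finset.range_subset_range.2 (show (M : ℕ) + 1 ≤ n + 1 by omega)) fun y _ _ =>
          mul_nonneg (c.wt_nonneg y) (c.iterate_avg_nonneg hf0 k y))
      rw [mul_comm]
      rw [Finset.mem_range] at hy
      exact mul_le_mul_of_nonneg_left (hc.iterate_anti hf k (by omega) hMn) (c.wt_nonneg y)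
    have h0 := c.iterate_avg_nonneg hf0 k M
    rw [← c.cum_eq_piLow] at hM
    have h2 : c.avg^[k] f M * (1 - δ) ≤ π := by nlinarith
    have h3 : 0 < 1 - δ := by linarith
    rw [← sub_nonneg]
    have h4 : c.avg^[k] f M ≤ π / (1 - δ) := (le_div_iff₀ h3).2 h2
    have h5 : π / (1 - δ) ≤ δ / (1 - δ) + π := by
      rw [div_add' _ _ _ h3.ne', div_le_div_iff_of_pos_right h3]
      nlinarith
    linarith
  have key : ∀ m, ∀ y ≤ M, c.avg^[m] f y ≤ c.hitSurv M y m + (δ / (1 - δ) + π) := by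
    intro m
    induction m with
    | zero =>
      intro y hy
      rcases hy.lt_or_eq with hy | rfl
      · rw [hitSurv_zero, if_neg hy.ne]
        have := hCM 0
        have := c.iterate_avg_nonneg hf0 0 M
        have := hf1 y
        simp only [Function.iterate_zero, id] at *
        linarith
      · rw [hitSurv_self, zero_add]; exact hCM 0
    | succ m ih =>
      intro y hy
      rcases hy.lt_or_eq with hy | rfl
      · rw [hitSurv_succ, if_neg hy.ne, Function.iterate_succ_apply', ← sum_K_eq_avg]
        refine (c.sum_K_mono_of_le hy ih).trans (le_of_eq ?_)
        simp only [mul_add (c.K y _), Finset.sum_add_distrib]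
        rw [← Finset.sum_mul, ← Finset.sum_mul, c.K_rowSum]
        ring
      · rw [hitSurv_self, zero_add]; exact hCM _
  have h1 := hc.iterate_anti hf m (Nat.zero_le x) (Nat.lt_succ_iff.1 x.2)
  have h2 := key m 0 (Fin.zero_le M)
  rw [Fin.val_zero] at h2
  linarith

end BDChain

namespace BDChain

variable {n : ℕ} (c : BDChain n)

lemma K_reversible (x y : Fin (n + 1)) : c.pi x * c.K x y = c.pi y * c.K y x := by
  simpa only [ker_val, wt_val] using c.ker_reversible x y

lemma K_pow_reversible (m : ℕ) (x y : Fin (n + 1)) :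
    c.pi x * (c.K ^ m) x y = c.pi y * (c.K ^ m) y x := by
  have h : SemiconjBy (Matrix.diagonal c.pi) c.K c.Kᵀ := by
    ext i j
    rw [Matrix.diagonal_mul, Matrix.mul_diagonal, Matrix.transpose_apply, c.K_reversible, mul_comm]
  have := congrFun (congrFun (h.pow_right m) x) y
  rw [Matrix.diagonal_mul, Matrix.mul_diagonal, ← Matrix.transpose_pow, Matrix.transpose_apply]
    at this
  rw [this, mul_comm]

lemma K_pow_nonneg (m : ℕ) (x y : Fin (n + 1)) : 0 ≤ (c.K ^ m) x y := by
  induction m generalizing x with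
  | zero => rw [pow_zero, Matrix.one_apply]; split_ifs <;> norm_num
  | succ m ih =>
    rw [pow_succ', Matrix.mul_apply]
    exact Finset.sum_nonneg fun z _ => mul_nonneg (c.K_nonneg _ _) (ih z)

lemma K_pow_rowSum (m : ℕ) (x : Fin (n + 1)) : ∑ y, (c.K ^ m) x y = 1 := by
  induction m generalizing x with
  | zero => simp [Matrix.one_apply]
  | succ m ih =>
    simp only [pow_succ', Matrix.mul_apply]
    rw [Finset.sum_comm]
    simp only [← Finset.mul_sum, ih, mul_one, c.K_rowSum]

variable {c}

lemma Sluggish.rev (hc : c.Sluggish) : c.rev.Sluggish := by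
  intro i j hij
  rcases Nat.lt_or_ge n i with h | h
  · rw [c.rev.ker_of_gt_left h]; norm_num
  rcases Nat.lt_or_ge n j with h' | h'
  · rw [c.rev.ker_of_gt_right h']; norm_num
  rw [c.rev_ker h h']
  exact hc _ _ (by omega)

lemma Sluggish.sum_excess_le (hc : c.Sluggish) {f : ℕ → ℝ} (hf0 : ∀ i, 0 ≤ f i)
    (hf1 : ∀ i, f i ≤ 1) (hf : ∀ i < n, f (i + 1) ≤ f i) {M : Fin (n + 1)} {δ : ℝ} (hδ : δ < 1)
    (hM : 1 - δ ≤ c.piLow M) (m : ℕ) (x : Fin (n + 1)) :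
    ∑ y : Fin (n + 1), f y * ((c.K ^ m) x y - c.pi y) ≤ c.hitSurv M 0 m + δ / (1 - δ) := by
  have h1 := hc.iterate_le_hitSurv hf0 hf1 hf hδ hM m x
  rw [← c.pow_mulVec_eq_iterate, ← sum_fin_eq_range] at h1
  simp only [Matrix.mulVec, dotProduct, wt_val] at h1
  have h2 : ∑ y : Fin (n + 1), f y * ((c.K ^ m) x y - c.pi y) =
      ∑ y : Fin (n + 1), (c.K ^ m) x y * f y - ∑ y : Fin (n + 1), c.pi y * f y := by
    rw [← Finset.sum_sub_distrib]
    exact Finset.sum_congr rfl fun y _ => by ring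
  linarith

lemma Sluggish.sum_excess_finset_le (hc : c.Sluggish) {M₁ M₂ : Fin (n + 1)} {δ : ℝ} (hδ : δ < 1)
    (h₁ : 1 - δ ≤ c.piHigh M₁) (h₂ : 1 - δ ≤ c.piLow M₂) (m : ℕ) (x : Fin (n + 1))
    (A : Finset (Fin (n + 1))) :
    ∑ y ∈ A, ((c.K ^ m) x y - c.pi y) ≤
      c.hitSurv M₂ 0 m + c.hitSurv M₁ (Fin.last n) m + 2 * (δ / (1 - δ)) := by
  set h : ℕ → ℝ := c.avg^[m] (fun i => if i = x then 1 else 0) with hh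
  have hval : ∀ y : Fin (n + 1), h y = (c.K ^ m) y x := by
    intro y
    rw [hh, ← c.pow_mulVec_eq_iterate]
    simp [Matrix.mulVec, dotProduct, ← Fin.ext_iff]
  have hx : (x : ℕ) ≤ n := Nat.lt_succ_iff.1 x.2
  obtain ⟨k, ⟨hk1, hk2⟩, -⟩ := hc.iterate_signChange
    (f := fun i => if i = x then (1 : ℝ) else 0) (k := x) ⟨fun i hi => by
      rcases Nat.lt_or_ge i n with hn | hn
      · rw [incr_of_lt hn]
        split_ifs <;> first | omega | norm_num
      · rw [incr_of_ge hn], fun i hi => by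
      rcases Nat.lt_or_ge i n with hn | hn
      · rw [incr_of_lt hn]
        split_ifs <;> first | omega | norm_num
      · rw [incr_of_ge hn]⟩ m
  rw [← hh] at hk1 hk2
  have he : ∀ y : Fin (n + 1), c.pi x * ((c.K ^ m) x y - c.pi y) = c.pi y * (h y - c.pi x) := by
    intro y
    rw [hval, mul_sub, mul_sub, c.K_pow_reversible, mul_comm (c.pi x) (c.pi y)]
  have hpos : ∀ y : Fin (n + 1), c.pi x ≤ h y → 0 ≤ (c.K ^ m) x y - c.pi y := fun y hy =>
    nonneg_of_mul_nonneg_right (by rw [he]; exact mul_nonneg (c.pi_pos y).le (by linarith))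
      (c.pi_pos x)
  have hneg : ∀ y : Fin (n + 1), ¬ c.pi x ≤ h y → (c.K ^ m) x y - c.pi y ≤ 0 := fun y hy => by
    have := he y
    nlinarith [c.pi_pos x, c.pi_pos y]
  classical
  set f : ℕ → ℝ := fun i => if i < k ∨ c.pi x ≤ h i then 1 else 0 with hf
  set g : ℕ → ℝ := fun i => if k ≤ n - i ∨ c.pi x ≤ h (n - i) then 1 else 0 with hg
  have hA : ∑ y ∈ A, ((c.K ^ m) x y - c.pi y) ≤
      ∑ y : Fin (n + 1), f y * ((c.K ^ m) x y - c.pi y) +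
      ∑ y : Fin (n + 1), g (n - y) * ((c.K ^ m) x y - c.pi y) := by
    have h0 : ∑ y : Fin (n + 1), ((c.K ^ m) x y - c.pi y) = 0 := by
      rw [Finset.sum_sub_distrib, c.K_pow_rowSum, c.pi_sum, sub_self]
    have h1 : ∑ y ∈ A, ((c.K ^ m) x y - c.pi y) =
        ∑ y, if y ∈ A then (c.K ^ m) x y - c.pi y else 0 := by simp
    have h2 : ∑ y ∈ A, ((c.K ^ m) x y - c.pi y) ≤ ∑ y : Fin (n + 1),
        (f y * ((c.K ^ m) x y - c.pi y) + g (n - y) * ((c.K ^ m) x y - c.pi y) -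
          ((c.K ^ m) x y - c.pi y)) := by
      rw [h1]
      refine Finset.sum_le_sum fun y _ => ?_
      have hny : n - (n - (y : ℕ)) = y := by omega
      simp only [hf, hg, hny]
      by_cases hH : c.pi x ≤ h y
      · have := hpos y hH
        simp only [hH, or_true, if_true]
        split_ifs <;> linarith
      · have := hneg y hH
        simp only [hH, or_false]
        rcases Nat.lt_or_ge y k with hy | hy
        · simp only [hy, if_true, if_neg (show ¬ k ≤ (y : ℕ) by omega)]
          split_ifs <;> linarith
        · simp only [hy, if_true, if_neg (show ¬ (y : ℕ) < k by omega)]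
          split_ifs <;> linarith
    have h3 := Finset.sum_sub_distrib (s := Finset.univ) (fun y : Fin (n + 1) =>
      f y * ((c.K ^ m) x y - c.pi y) + g (n - y) * ((c.K ^ m) x y - c.pi y))
      (fun y => (c.K ^ m) x y - c.pi y)
    rw [Finset.sum_add_distrib, h0, sub_zero] at h3
    rwa [h3] at h2
  have hB := hc.sum_excess_le (f := f) (fun i => by simp only [hf]; split_ifs <;> norm_num)
    (fun i => by simp only [hf]; split_ifs <;> norm_num) (fun i hi => by
      simp only [hf]
      split_ifs with h3 h4 h4
      · exact le_rfl
      · exfalso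
        push Not at h4
        rcases h3 with h3 | h3
        · omega
        · have := hk2 i h4.1
          rw [incr_of_lt hi] at this
          linarith [h4.2]
      · norm_num
      · exact le_rfl) hδ h₂ m x
  have hC := hc.rev.sum_excess_le (f := g) (fun i => by simp only [hg]; split_ifs <;> norm_num)
    (fun i => by simp only [hg]; split_ifs <;> norm_num) (fun i hi => by
      simp only [hg]
      split_ifs with h3 h4 h4
      · exact le_rfl
      · exfalso
        push Not at h4
        rcases h3 with h3 | h3
        · omega
        · have := hk1 (n - (i + 1)) (by omega)
          rw [incr_of_lt (by omega), show n - (i + 1) + 1 = n - i by omega] at this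
          linarith [h4.2]
      · norm_num
      · exact le_rfl) hδ (M := M₁.rev) (by rw [rev_piLow]; exact h₁) m x.rev
  rw [rev_hitSurv, Fin.rev_rev, Fin.rev_zero, ← sum_rev] at hC
  simp only [rev_K_pow, Fin.rev_rev, rev_pi, Fin.val_rev, Nat.add_sub_add_right] at hC
  linarith

variable (c)

/-- The chain slowed down by the holding probability `3 / 4`. -/
def lazy : BDChain n where
  K := (3 / 4 : ℝ) • (1 : Matrix (Fin (n + 1)) (Fin (n + 1)) ℝ) + (1 / 4 : ℝ) • c.K
  pi := c.pi
  K_nonneg i j := by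
    have := c.K_nonneg i j
    simp only [Matrix.add_apply, Matrix.smul_apply, Matrix.one_apply, smul_eq_mul]
    split_ifs <;> linarith
  K_rowSum i := by
    simp only [Matrix.add_apply, Matrix.smul_apply, Matrix.one_apply, smul_eq_mul,
      Finset.sum_add_distrib, ← Finset.mul_sum, c.K_rowSum]
    norm_num
  K_tridiag i j h := by
    have hij : i ≠ j := by rintro rfl; simp at h
    simp [c.K_tridiag i j h, hij]
  K_irred i h := by
    have := c.K_irred i h
    simp [this.1, this.2]
  pi_pos := c.pi_pos
  pi_sum := c.pi_sum
  pi_stat j := by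
    simp only [Matrix.add_apply, Matrix.smul_apply, smul_eq_mul, mul_add, Finset.sum_add_distrib,
      Matrix.one_apply]
    have := c.pi_stat j
    simp only [mul_left_comm _ (1 / 4 : ℝ), ← Finset.mul_sum, this]
    simp
    ring

lemma lazy_K : c.lazy.K =
    (3 / 4 : ℝ) • (1 : Matrix (Fin (n + 1)) (Fin (n + 1)) ℝ) + (1 / 4 : ℝ) • c.K := rfl

lemma lazy_sluggish : c.lazy.Sluggish := by
  intro i j hij
  unfold ker
  split_ifs with h
  · have h1 : c.K ⟨i, h.1⟩ ⟨j, h.2⟩ ≤ 1 := by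
      rw [← c.K_rowSum ⟨i, h.1⟩]
      exact Finset.single_le_sum (f := fun j => c.K ⟨i, h.1⟩ j) (fun y _ => c.K_nonneg _ _)
        (Finset.mem_univ _)
    simp [lazy_K, hij]
    linarith
  · norm_num

lemma abs_K_pow_mulVec_le {v : Fin (n + 1) → ℝ} {B : ℝ} (hv : ∀ y, |v y| ≤ B) (m : ℕ)
    (x : Fin (n + 1)) : |((c.K ^ m) *ᵥ v) x| ≤ B := by
  calc |((c.K ^ m) *ᵥ v) x| = |∑ y, (c.K ^ m) x y * v y| := rfl
    _ ≤ ∑ y, |(c.K ^ m) x y * v y| := Finset.abs_sum_le_sum_abs _ _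
    _ ≤ ∑ y, (c.K ^ m) x y * B := Finset.sum_le_sum fun y _ => by
      rw [abs_mul, abs_of_nonneg (c.K_pow_nonneg m x y)]
      exact mul_le_mul_of_nonneg_left (hv y) (c.K_pow_nonneg m x y)
    _ = B := by rw [← Finset.sum_mul, c.K_pow_rowSum, one_mul]

lemma K_pow_abs_le (m : ℕ) (x y : Fin (n + 1)) : |(c.K ^ m) x y| ≤ 1 := by
  rw [abs_of_nonneg (c.K_pow_nonneg m x y), ← c.K_pow_rowSum m x]
  exact Finset.single_le_sum (f := fun y => (c.K ^ m) x y) (fun y _ => c.K_pow_nonneg _ _ _)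
    (Finset.mem_univ y)

/-- Expectations of the continuous-time chain are Poisson averages of those of the discrete one. -/
lemma sum_Ht_mul (t : ℝ) (x : Fin (n + 1)) (v : Fin (n + 1) → ℝ) :
    ∑ y, c.Ht t x y * v y = poissonAvg (fun m => ((c.K ^ m) *ᵥ v) x) t := by
  unfold poissonAvg Ht
  simp only [Matrix.mulVec, dotProduct, Finset.mul_sum, ← mul_assoc]
  rw [Summable.tsum_finsetSum fun y _ =>
    (poisson_summable (fun m => c.K_pow_abs_le m x y) t).mul_right _]
  simp only [tsum_mul_right]

lemma sum_Ht_eq_lazy (t : ℝ) (x : Fin (n + 1)) (v : Fin (n + 1) → ℝ) :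
    ∑ y, c.Ht t x y * v y = poissonAvg (fun m => ((c.lazy.K ^ m) *ᵥ v) x) (4 * t) := by
  rw [sum_Ht_mul, lazy_K, poissonAvg_thinning c.K v x (B := ∑ y, |v y|)]
  exact fun j => c.abs_K_pow_mulVec_le (fun y => Finset.single_le_sum (f := fun y => |v y|)
    (fun y _ => abs_nonneg _) (Finset.mem_univ y)) j x

/-- The transition matrix with the row of the state `i` set to zero. -/
def killRow (i : Fin (n + 1)) : Matrix (Fin (n + 1)) (Fin (n + 1)) ℝ :=
  Matrix.of fun x y => if x = i then 0 else c.K x y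

lemma hitSurv_eq_killRow (i j : Fin (n + 1)) (m : ℕ) :
    c.hitSurv i j m = ((c.killRow i ^ m) *ᵥ fun y => if y = i then 0 else 1) j := by
  induction m generalizing j with
  | zero => simp [hitSurv_zero]
  | succ m ih =>
    rw [hitSurv_succ, pow_succ', ← Matrix.mulVec_mulVec]
    simp only [ih]
    by_cases h : j = i <;> simp [Matrix.mulVec, dotProduct, killRow, h]

lemma lazy_hitSurv_eq_killRow (i j : Fin (n + 1)) (m : ℕ) :
    c.lazy.hitSurv i j m = ((((3 / 4 : ℝ) • (1 : Matrix (Fin (n + 1)) (Fin (n + 1)) ℝ) +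
      (1 / 4 : ℝ) • c.killRow i) ^ m) *ᵥ fun y => if y = i then 0 else 1) j := by
  induction m generalizing j with
  | zero => simp [hitSurv_zero]
  | succ m ih =>
    have h2 : ∀ v : Fin (n + 1) → ℝ, ∑ y, c.lazy.K j y * v y =
        3 / 4 * v j + 1 / 4 * ∑ y, c.K j y * v y := by
      intro v
      simp only [lazy_K, Matrix.add_apply, Matrix.smul_apply, smul_eq_mul, add_mul,
        Finset.sum_add_distrib, mul_assoc, ← Finset.mul_sum, Matrix.one_apply]
      simp
    rw [hitSurv_succ, pow_succ', ← Matrix.mulVec_mulVec, h2]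
    simp only [ih, Matrix.add_mulVec, Matrix.smul_mulVec, Matrix.one_mulVec, Pi.add_apply,
      Pi.smul_apply, smul_eq_mul]
    by_cases h : j = i
    · subst h
      rw [← ih, hitSurv_self]
      simp [Matrix.mulVec, dotProduct, killRow]
    · simp [Matrix.mulVec, dotProduct, killRow, h]

lemma hitSurvC_eq_lazy (i j : Fin (n + 1)) (t : ℝ) :
    c.hitSurvC i j t = c.lazy.hitSurvC i j (4 * t) := by
  rw [hitSurvC_eq, hitSurvC_eq]
  have h1 : c.hitSurv i j = fun m => ((c.killRow i ^ m) *ᵥ fun y => if y = i then 0 else 1) j :=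
    funext fun m => c.hitSurv_eq_killRow i j m
  have h2 := funext fun m => c.lazy_hitSurv_eq_killRow i j m
  rw [h2, poissonAvg_thinning (B := 1), ← h1]
  intro m
  rw [← hitSurv_eq_killRow]
  exact c.hitSurv_abs_le i j m

lemma sum_Ht_finset (t : ℝ) (x : Fin (n + 1)) (A : Finset (Fin (n + 1))) :
    ∑ y ∈ A, c.Ht t x y = ∑ y, c.Ht t x y * (if y ∈ A then 1 else 0) := by
  simp

lemma dTVMaxC_le {M₁ M₂ : Fin (n + 1)} {δ : ℝ} (hδ : δ < 1) (h₁ : 1 - δ ≤ c.piHigh M₁)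
    (h₂ : 1 - δ ≤ c.piLow M₂) {t : ℝ} (ht : 0 ≤ t) :
    c.dTVMaxC t ≤ c.hitSurvC M₂ 0 t + c.hitSurvC M₁ (Fin.last n) t + 2 * (δ / (1 - δ)) := by
  refine ciSup_le fun x => ciSup_le fun A => ?_
  rw [sum_Ht_finset, sum_Ht_eq_lazy, c.hitSurvC_eq_lazy M₂ 0 t,
    c.hitSurvC_eq_lazy M₁ (Fin.last n) t, hitSurvC_eq, hitSurvC_eq]
  have hadd := poissonAvg_add (c.lazy.hitSurv_abs_le M₂ 0)
    (c.lazy.hitSurv_abs_le M₁ (Fin.last n)) (4 * t)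
  have hsum : ∀ m, |c.lazy.hitSurv M₂ 0 m + c.lazy.hitSurv M₁ (Fin.last n) m| ≤ 2 := fun m =>
    (abs_add_le _ _).trans ((add_le_add (c.lazy.hitSurv_abs_le M₂ 0 m)
      (c.lazy.hitSurv_abs_le M₁ (Fin.last n) m)).trans (by norm_num))
  set b := 2 * (δ / (1 - δ)) + ∑ y ∈ A, c.pi y with hb
  have h3 := poissonAvg_add hsum (s' := fun _ => b) (B' := abs b) (fun _ => le_rfl) (4 * t)
  rw [poissonAvg_const] at h3
  have h4 := poissonAvg_mono (s := fun m => ((c.lazy.K ^ m) *ᵥ fun y => if y ∈ A then 1 else 0) x)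
    (B := 1) (s' := fun m => c.lazy.hitSurv M₂ 0 m + c.lazy.hitSurv M₁ (Fin.last n) m + b)
    (B' := 2 + abs b) (fun m => c.lazy.abs_K_pow_mulVec_le (fun y => by split_ifs <;> simp) m x)
    (fun m => (abs_add_le _ _).trans (add_le_add (hsum m) le_rfl)) (fun m => ?_)
    (t := 4 * t) (by linarith)
  · linarith
  · have := c.lazy_sluggish.sum_excess_finset_le hδ h₁ h₂ m x A
    rw [Finset.sum_sub_distrib] at this
    have h5 : ((c.lazy.K ^ m) *ᵥ fun y => if y ∈ A then (1 : ℝ) else 0) x =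
        ∑ y ∈ A, (c.lazy.K ^ m) x y := by
      simp [Matrix.mulVec, dotProduct]
    have h6 : ∑ y ∈ A, c.lazy.pi y = ∑ y ∈ A, c.pi y := rfl
    rw [h5]
    linarith

end BDChain

namespace BDChain

variable {n : ℕ} (c : BDChain n)

lemma le_dTVMaxC (t : ℝ) (x : Fin (n + 1)) (A : Finset (Fin (n + 1))) :
    ∑ y ∈ A, c.Ht t x y - ∑ y ∈ A, c.pi y ≤ c.dTVMaxC t :=
  (le_ciSup (f := fun A => ∑ y ∈ A, c.Ht t x y - ∑ y ∈ A, c.pi y)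
    (Set.finite_range _).bddAbove A).trans
    (le_ciSup (f := fun x => c.dTVC x t) (Set.finite_range _).bddAbove x)

lemma hitSurv_le_K_pow_mulVec {M x : Fin (n + 1)} (hx : x ≤ M) (m : ℕ) :
    c.hitSurv M x m ≤ ((c.K ^ m) *ᵥ fun y => if y < M then (1 : ℝ) else 0) x := by
  induction m generalizing x with
  | zero =>
    rw [hitSurv_zero, pow_zero, Matrix.one_mulVec]
    rcases hx.eq_or_lt with h | h
    · simp [h]
    · simp [h, h.ne]
  | succ m ih =>
    rw [hitSurv_succ]
    rcases hx.eq_or_lt with h | h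
    · rw [if_pos h]
      simp only [Matrix.mulVec, dotProduct]
      exact Finset.sum_nonneg fun y _ => mul_nonneg (c.K_pow_nonneg _ _ _)
        (by split_ifs <;> norm_num)
    · rw [if_neg h.ne, pow_succ', ← Matrix.mulVec_mulVec]
      exact c.sum_K_mono_of_le h fun y hy => ih hy

lemma piHigh_add_sum_lt (M : Fin (n + 1)) :
    c.piHigh M + ∑ y ∈ Finset.univ.filter (· < M), c.pi y = 1 := by
  rw [piHigh, Finset.sum_filter, ← Finset.sum_add_distrib, ← c.pi_sum]
  refine Finset.sum_congr rfl fun y _ => ?_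
  by_cases h : y < M
  · simp [h]
  · simp [h, not_lt.1 h]

/-- The chain started at `0` is far from equilibrium as long as it is unlikely to have passed a
state below which there is little mass. -/
lemma hitSurvC_zero_le_dTVMaxC (M : Fin (n + 1)) {t : ℝ} (ht : 0 ≤ t) :
    c.hitSurvC M 0 t + c.piHigh M - 1 ≤ c.dTVMaxC t := by
  have h1 := c.le_dTVMaxC t 0 (Finset.univ.filter (· < M))
  rw [sum_Ht_finset, sum_Ht_mul] at h1
  have h2 := poissonAvg_mono (s' := fun m => ((c.K ^ m) *ᵥ fun y =>
    if y ∈ Finset.univ.filter (· < M) then (1 : ℝ) else 0) 0) (c.hitSurv_abs_le M 0)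
    (fun m => c.abs_K_pow_mulVec_le (B := 1) (fun y => by split_ifs <;> simp) m 0)
    (fun m => by simpa using c.hitSurv_le_K_pow_mulVec (Fin.zero_le M) m) ht
  rw [← hitSurvC_eq] at h2
  linarith [c.piHigh_add_sum_lt M]

lemma rev_piHigh (M : Fin (n + 1)) : c.rev.piHigh M.rev = c.piLow M := by
  rw [piHigh, piLow, ← sum_rev]
  simp [rev_pi]

lemma hitSurvC_last_le_dTVMaxC (M : Fin (n + 1)) {t : ℝ} (ht : 0 ≤ t) :
    c.hitSurvC M (Fin.last n) t + c.piLow M - 1 ≤ c.dTVMaxC t := by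
  have := c.rev.hitSurvC_zero_le_dTVMaxC M.rev ht
  rwa [rev_piHigh, rev_hitSurvC, rev_dTVMaxC, Fin.rev_rev, Fin.rev_zero] at this

lemma sum_Ht (t : ℝ) (x : Fin (n + 1)) : ∑ y, c.Ht t x y = 1 := by
  have := c.sum_Ht_mul t x fun _ => 1
  simpa [Matrix.mulVec, dotProduct, c.K_pow_rowSum, poissonAvg_const] using this

lemma sum_abs_Ht_sub_le (t : ℝ) (x : Fin (n + 1)) :
    ∑ y, |c.Ht t x y - c.pi y| ≤ 2 * c.dTVMaxC t := by
  classical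
  have h1 := c.le_dTVMaxC t x (Finset.univ.filter fun y => 0 ≤ c.Ht t x y - c.pi y)
  rw [← Finset.sum_sub_distrib, Finset.sum_filter] at h1
  have h2 : ∑ y, (c.Ht t x y - c.pi y) = 0 := by
    rw [Finset.sum_sub_distrib, c.sum_Ht, c.pi_sum, sub_self]
  have h3 : ∑ y, |c.Ht t x y - c.pi y| =
      2 * (∑ y, if 0 ≤ c.Ht t x y - c.pi y then c.Ht t x y - c.pi y else 0) -
        ∑ y, (c.Ht t x y - c.pi y) := by
    rw [Finset.mul_sum, ← Finset.sum_sub_distrib]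
    refine Finset.sum_congr rfl fun y _ => ?_
    split_ifs with h
    · rw [abs_of_nonneg h]; ring
    · rw [abs_of_neg (not_le.1 h)]; ring
  linarith

lemma poissonAvg_geometric (r b t : ℝ) :
    poissonAvg (fun m => r ^ m * b) t = Real.exp (-((1 - r) * t)) * b := by
  have h : HasSum (fun m : ℕ => Real.exp (-t) * ((t * r) ^ m / m.factorial) * b)
      (Real.exp (-t) * Real.exp (t * r) * b) := by
    rw [Real.exp_eq_exp_ℝ]
    exact ((NormedSpace.expSeries_div_hasSum_exp (t * r)).mul_left _).mul_right _
  rw [← Real.exp_add, show -t + t * r = -((1 - r) * t) by ring] at h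
  rw [← h.tsum_eq, poissonAvg]
  exact tsum_congr fun m => by rw [mul_pow]; ring

lemma exp_le_dTVMaxC {l : ℝ} (hl : IsSmallestNonzeroEig (1 - c.K) l) (t : ℝ) :
    Real.exp (-(l * t)) / 2 ≤ c.dTVMaxC t := by
  obtain ⟨φ, ⟨i, hi, hφi⟩, hφ, hmean⟩ := exists_eigenfunction hl
  obtain ⟨x, -, hx⟩ := Finset.exists_max_image (Finset.univ : Finset (Fin (n + 1)))
    (fun y => |φ y|) ⟨0, Finset.mem_univ _⟩
  have hpos : 0 < |φ x| := (abs_pos.2 hφi).trans_le (hx ⟨i, hi⟩ (Finset.mem_univ _))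
  have hpow : ∀ m : ℕ, (c.K ^ m) *ᵥ (fun y : Fin (n + 1) => φ y) =
      (1 - l) ^ m • fun y : Fin (n + 1) => φ y := by
    intro m
    induction m with
    | zero => simp
    | succ m ih =>
      rw [pow_succ', ← Matrix.mulVec_mulVec, ih, Matrix.mulVec_smul, pow_succ, mul_smul]
      congr 1
      ext y
      have h1 : (c.K *ᵥ fun y : Fin (n + 1) => φ y) y = c.avg φ y := c.sum_K_eq_avg φ y
      have h2 := hφ y y.2
      rw [h1, Pi.smul_apply, smul_eq_mul]
      linarith
  have h1 := c.sum_Ht_mul t x fun y => φ y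
  simp only [hpow, Pi.smul_apply, smul_eq_mul] at h1
  rw [poissonAvg_geometric, sub_sub_cancel] at h1
  have h2 : ∑ y : Fin (n + 1), c.pi y * φ y = 0 := by
    rw [← sum_fin_eq_range] at hmean
    simpa only [wt_val] using hmean
  have h3 : ∑ y : Fin (n + 1), (c.Ht t x y - c.pi y) * φ y = Real.exp (-(l * t)) * φ x := by
    simp only [sub_mul]
    rw [Finset.sum_sub_distrib, h1, h2, sub_zero]
  have h4 : Real.exp (-(l * t)) * |φ x| ≤ (∑ y, |c.Ht t x y - c.pi y|) * |φ x| := by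
    calc Real.exp (-(l * t)) * |φ x| = |∑ y : Fin (n + 1), (c.Ht t x y - c.pi y) * φ y| := by
          rw [h3, abs_mul, abs_of_pos (Real.exp_pos _)]
      _ ≤ ∑ y : Fin (n + 1), |(c.Ht t x y - c.pi y) * φ y| := Finset.abs_sum_le_sum_abs _ _
      _ ≤ ∑ y : Fin (n + 1), |c.Ht t x y - c.pi y| * |φ x| := Finset.sum_le_sum fun y hy => by
          rw [abs_mul]
          exact mul_le_mul_of_nonneg_left (hx y hy) (abs_nonneg _)
      _ = _ := (Finset.sum_mul _ _ _).symm
  linarith [le_of_mul_le_mul_right h4 hpos, c.sum_abs_Ht_sub_le t x]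

lemma piLow_add_piHigh (M : Fin (n + 1)) : c.piLow M + c.piHigh M = 1 + c.pi M := by
  have h : c.pi M = ∑ y, if y = M then c.pi y else 0 := by simp
  rw [h, ← c.pi_sum, piLow, piHigh, ← Finset.sum_add_distrib, ← Finset.sum_add_distrib]
  refine Finset.sum_congr rfl fun y _ => ?_
  rcases lt_trichotomy y M with h | h | h
  · simp [h.le, h.ne, h.not_ge]
  · simp [h]
  · simp [h.le, h.ne', h.not_ge]

lemma one_sub_cum_ge {M : Fin (n + 1)} {δ : ℝ} (h : δ ≤ c.piHigh M) {z : ℕ} (hz : z < M) :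
    δ ≤ 1 - c.cum z := by
  have h1 : c.cum z ≤ c.cum (M - 1) := c.cum_mono (by omega)
  have h2 := c.cum_succ (M - 1)
  rw [Nat.sub_add_cancel (by omega), cum_eq_piLow, wt_val] at h2
  linarith [c.piLow_add_piHigh M]

/-- Existence of quantiles. -/
lemma exists_quantile {δ : ℝ} (h0 : 0 ≤ δ) (h1 : δ ≤ 1) :
    ∃ M : Fin (n + 1), 1 - δ ≤ c.piLow M ∧ δ ≤ c.piHigh M := by
  classical
  have hex : ∃ k, 1 - δ ≤ c.cum k := ⟨n, by rw [cum_top]; linarith⟩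
  obtain ⟨k, hk, hmin⟩ : ∃ k, 1 - δ ≤ c.cum k ∧ ∀ j < k, ¬ 1 - δ ≤ c.cum j :=
    ⟨Nat.find hex, Nat.find_spec hex, fun j hj => Nat.find_min hex hj⟩
  have hle : k ≤ n := not_lt.1 fun h => hmin n h (by rw [cum_top]; linarith)
  have hsum := c.piLow_add_piHigh ⟨k, by omega⟩
  rw [← cum_eq_piLow, ← wt_val] at hsum
  refine ⟨⟨k, by omega⟩, (c.cum_eq_piLow ⟨k, by omega⟩).symm ▸ hk, ?_⟩
  rcases Nat.eq_zero_or_pos k with rfl | h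
  · simp only [cum, zero_add, Finset.sum_range_one] at hsum
    linarith
  · have h2 := hmin (k - 1) (by omega)
    have h3 := c.cum_succ (k - 1)
    rw [Nat.sub_add_cancel h] at h3
    linarith

end BDChain

namespace BDChain

variable {n : ℕ} {c : BDChain n} {l δ α t : ℝ} {a b M : Fin (n + 1)}

lemma climbMean_le_add (hl : IsSmallestNonzeroEig (1 - c.K) l) (hδ : 0 < δ)
    (ha : δ ≤ c.piLow a) (hb : δ ≤ c.piHigh b) :
    c.climbMean b ≤ c.climbMean a + 1 / (l * δ ^ 2) := by
  have hl0 := gap_pos hl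
  have hp : 0 < l * δ ^ 2 := by positivity
  rcases le_total a b with h | h
  · have := climbMean_sub_le hl hδ hδ (show (a : ℕ) ≤ b from h) (Nat.lt_succ_iff.1 b.2)
      (fun z hz => c.one_sub_cum_ge hb hz) (by rwa [cum_eq_piLow])
    have h2 : c.climbMean b - c.climbMean a ≤ 1 / (l * δ ^ 2) := by
      rw [le_div_iff₀ hp]
      linarith
    linarith
  · have := c.climbMean_mono (show (b : ℕ) ≤ a from h)
    have : 0 < 1 / (l * δ ^ 2) := by positivity
    linarith

lemma climbVar_le_add (hl : IsSmallestNonzeroEig (1 - c.K) l) (hδ : 0 < δ)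
    (ha : δ ≤ c.piLow a) (hb : δ ≤ c.piHigh b) :
    c.climbVar b ≤ c.climbVar a + 2 / (l ^ 2 * δ ^ 3) := by
  have hl0 := gap_pos hl
  have hp : 0 < l ^ 2 * δ ^ 3 := by positivity
  rcases le_total a b with h | h
  · have h1 := climbMean_sub_le hl hδ hδ (show (a : ℕ) ≤ b from h) (Nat.lt_succ_iff.1 b.2)
      (fun z hz => c.one_sub_cum_ge hb hz) (by rwa [cum_eq_piLow])
    have h2 := climbVar_sub_le hl (show (a : ℕ) ≤ b from h) (Nat.lt_succ_iff.1 b.2)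
      (fun z hz => c.one_sub_cum_ge hb hz)
    have h3 : c.climbVar b - c.climbVar a ≤ 2 / (l ^ 2 * δ ^ 3) := by
      rw [le_div_iff₀ hp]
      have := mul_le_mul_of_nonneg_left h2 (show 0 ≤ l * δ ^ 2 by positivity)
      linarith
    linarith
  · have := c.climbVar_mono (show (b : ℕ) ≤ a from h)
    have : 0 < 2 / (l ^ 2 * δ ^ 3) := by positivity
    linarith

lemma climbMean_le_add_window (hl : IsSmallestNonzeroEig (1 - c.K) l) (hδ : 0 < δ)
    (hlα : 1 ≤ l * α) (ha : δ ≤ c.piLow a) (hb : δ ≤ c.piHigh b) :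
    c.climbMean b ≤ c.climbMean a + α / δ ^ 2 := by
  have hl0 := gap_pos hl
  have : 1 / (l * δ ^ 2) ≤ α / δ ^ 2 := by
    rw [div_le_div_iff₀ (by positivity) (by positivity)]
    nlinarith [sq_nonneg δ]
  linarith [climbMean_le_add hl hδ ha hb]

lemma climbVar_le_window (hl : IsSmallestNonzeroEig (1 - c.K) l) (hδ : 0 < δ) (hδ1 : δ ≤ 1)
    (hlα : 1 ≤ l * α) (hv : c.climbVar a ≤ α ^ 2) (ha : δ ≤ c.piLow a)
    (hb : δ ≤ c.piHigh b) : c.climbVar b * δ ^ 3 ≤ 3 * α ^ 2 := by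
  have hl0 := gap_pos hl
  have hsq : 1 ≤ l ^ 2 * α ^ 2 := by nlinarith
  have h1 : 2 / (l ^ 2 * δ ^ 3) * δ ^ 3 ≤ 2 * α ^ 2 := by
    rw [div_mul_eq_mul_div, div_le_iff₀ (by positivity)]
    have : 0 < δ ^ 3 := by positivity
    nlinarith
  have h2 : α ^ 2 * δ ^ 3 ≤ α ^ 2 := mul_le_of_le_one_right (sq_nonneg α) (pow_le_one₀ hδ.le hδ1)
  have h3 := mul_le_mul_of_nonneg_right (climbVar_le_add hl hδ ha hb)
    (show 0 ≤ δ ^ 3 by positivity)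
  have h4 := mul_le_mul_of_nonneg_right hv (show 0 ≤ δ ^ 3 by positivity)
  linarith

lemma le_of_mul_sq_le_window {p s v : ℝ} (hδ : 0 < δ) (hα : 0 < α)
    (hv : v * δ ^ 3 ≤ 3 * α ^ 2) (hs : 2 * (α / δ ^ 2) ≤ s) (h : p * s ^ 2 ≤ v) : p ≤ δ := by
  by_contra! hp
  have h1 : (2 * (α / δ ^ 2)) ^ 2 ≤ s ^ 2 := pow_le_pow_left₀ (by positivity) hs 2
  have h2 : δ * (2 * (α / δ ^ 2)) ^ 2 * δ ^ 3 = 4 * α ^ 2 := by field_simp; norm_num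
  have h3 : δ * (2 * (α / δ ^ 2)) ^ 2 ≤ v :=
    (mul_le_mul hp.le h1 (by positivity) (hδ.le.trans hp.le)).trans h
  have h4 := mul_le_mul_of_nonneg_right h3 (show 0 ≤ δ ^ 3 by positivity)
  nlinarith [sq_pos_of_pos hα]

lemma hitSurvC_zero_le_of_ge (hl : IsSmallestNonzeroEig (1 - c.K) l) (hδ : 0 < δ) (hδ1 : δ ≤ 1)
    (hα : 0 < α) (hlα : 1 ≤ l * α) (hv : c.climbVar a ≤ α ^ 2) (ha : δ ≤ c.piLow a)
    (hb : δ ≤ c.piHigh b) (ht : c.climbMean a + 3 * (α / δ ^ 2) ≤ t) :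
    c.hitSurvC b 0 t ≤ δ := by
  have h1 := climbMean_le_add_window hl hδ hlα ha hb
  have hq : 0 < α / δ ^ 2 := by positivity
  have h2 := c.hitSurvC_mul_sq_le (Fin.zero_le b) (t := t)
    (by rw [hitMeanC_zero]; exact c.climbMean_nonneg b) (by rw [hitMeanC_zero]; linarith)
  rw [hitMeanC_zero, hitVarC_zero] at h2
  exact le_of_mul_sq_le_window hδ hα (climbVar_le_window hl hδ hδ1 hlα hv ha hb)
    (by linarith) h2

lemma one_sub_hitSurvC_zero_le_of_le (hl : IsSmallestNonzeroEig (1 - c.K) l) (hδ : 0 < δ)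
    (hδ1 : δ ≤ 1) (hα : 0 < α) (hlα : 1 ≤ l * α) (hv : c.climbVar a ≤ α ^ 2)
    (ha : δ ≤ c.piLow a) (ha' : δ ≤ c.piHigh a) (hb : δ ≤ c.piLow b) (hb' : δ ≤ c.piHigh b)
    (ht0 : 0 ≤ t) (ht : t ≤ c.climbMean a - 3 * (α / δ ^ 2)) : 1 - c.hitSurvC b 0 t ≤ δ := by
  have h1 := climbMean_le_add_window hl hδ hlα hb ha'
  have hq : 0 < α / δ ^ 2 := by positivity
  have h2 := c.one_sub_hitSurvC_mul_sq_le (Fin.zero_le b) ht0 (by rw [hitMeanC_zero]; linarith)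
  rw [hitMeanC_zero, hitVarC_zero, ← neg_sub (c.climbMean b) t, neg_sq] at h2
  exact le_of_mul_sq_le_window hδ hα (climbVar_le_window hl hδ hδ1 hlα hv ha hb')
    (by linarith) h2

variable (c M) in
/-- The larger of the mean hitting times of `M` from the two ends. -/
def endMean : ℝ := max (c.hitMeanC M 0) (c.hitMeanC M (Fin.last n))

variable (c M) in
/-- The larger of the standard deviations of the hitting times of `M` from the two ends. -/
def endDev : ℝ := Real.sqrt (max (c.hitVarC M 0) (c.hitVarC M (Fin.last n)))

variable (c M) in
lemma endMean_eq : c.endMean M = max (c.climbMean M) (c.rev.climbMean M.rev) := by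
  rw [endMean, hitMeanC_zero, hitMeanC_last, Fin.val_rev, Nat.add_sub_add_right]

variable (c M) in
lemma endDev_sq : c.endDev M ^ 2 = max (c.climbVar M) (c.rev.climbVar M.rev) := by
  rw [endDev, hitVarC_zero, hitVarC_last, Fin.val_rev, Nat.add_sub_add_right,
    Real.sq_sqrt (le_max_of_le_left (c.climbVar_nonneg M))]

lemma one_le_gap_mul_endDev (hl : IsSmallestNonzeroEig (1 - c.K) l) : 1 ≤ l * c.endDev M := by
  have h := c.one_le_gap_sq_mul_climbVar hl (Nat.lt_succ_iff.1 M.2)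
  have h2 := c.endDev_sq M
  rw [Fin.val_rev, Nat.add_sub_add_right] at h2
  rw [← h2, ← mul_pow] at h
  exact (one_le_sq_iff₀ (mul_nonneg (gap_pos hl).le (Real.sqrt_nonneg _))).1 h

lemma endDev_pos (hl : IsSmallestNonzeroEig (1 - c.K) l) : 0 < c.endDev M :=
  pos_of_mul_pos_right (zero_lt_one.trans_le (one_le_gap_mul_endDev hl)) (gap_pos hl).le

lemma gap_mul_climbVar_le (hl : IsSmallestNonzeroEig (1 - c.K) l) (hM : δ ≤ c.piHigh M) :
    l * δ * c.climbVar M ≤ 2 * c.climbMean M := by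
  have := climbVar_sub_le hl (Nat.zero_le M) (Nat.lt_succ_iff.1 M.2)
    (fun z hz => c.one_sub_cum_ge hM hz)
  simpa [climbVar, climbMean] using this

lemma gap_mul_endDev_sq_le (hl : IsSmallestNonzeroEig (1 - c.K) l) (hδ : 0 < δ)
    (h₁ : δ ≤ c.piLow M) (h₂ : δ ≤ c.piHigh M) :
    l * δ * c.endDev M ^ 2 ≤ 2 * c.endMean M := by
  rw [endDev_sq, endMean_eq, mul_max_of_nonneg _ _ (mul_nonneg (gap_pos hl).le hδ.le)]
  refine max_le ((gap_mul_climbVar_le hl h₂).trans ?_)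
    ((gap_mul_climbVar_le (c.rev_gap hl) (by rwa [rev_piHigh])).trans ?_)
  · linarith [le_max_left (c.climbMean M) (c.rev.climbMean M.rev)]
  · linarith [le_max_right (c.climbMean M) (c.rev.climbMean M.rev)]

lemma dTVMaxC_le_of_ge (hl : IsSmallestNonzeroEig (1 - c.K) l) (hδ : 0 < δ) (hδ1 : δ ≤ 1 / 2)
    (h₁ : δ ≤ c.piLow M) (h₂ : δ ≤ c.piHigh M)
    (ht : c.endMean M + 3 * (c.endDev M / δ ^ 2) ≤ t) : c.dTVMaxC t ≤ 6 * δ := by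
  obtain ⟨M₂, h3, h4⟩ := c.exists_quantile hδ.le (by linarith : δ ≤ 1)
  obtain ⟨M₁, h5, h6⟩ := c.exists_quantile (by linarith : 0 ≤ 1 - δ) (by linarith)
  rw [sub_sub_cancel] at h5
  have hα := endDev_pos (M := M) hl
  have hlα := one_le_gap_mul_endDev (M := M) hl
  have hsq := c.endDev_sq M
  rw [endMean_eq] at ht
  have hq : 0 < c.endDev M / δ ^ 2 := by positivity
  have ht0 : 0 ≤ t := by
    linarith [c.climbMean_nonneg M, le_max_left (c.climbMean M) (c.rev.climbMean M.rev)]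
  have h7 : c.hitSurvC M₂ 0 t ≤ δ :=
    hitSurvC_zero_le_of_ge hl hδ (by linarith) hα hlα (hsq ▸ le_max_left _ _) h₁ h4
      (by linarith [le_max_left (c.climbMean M) (c.rev.climbMean M.rev)])
  have h8 : c.rev.hitSurvC M₁.rev 0 t ≤ δ :=
    hitSurvC_zero_le_of_ge (c.rev_gap hl) hδ (by linarith) hα hlα (a := M.rev)
      (hsq ▸ le_max_right _ _) (by rwa [rev_piLow]) (by rwa [rev_piHigh])
      (by linarith [le_max_right (c.climbMean M) (c.rev.climbMean M.rev)])
  rw [rev_hitSurvC, Fin.rev_rev, Fin.rev_zero] at h8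
  have h9 := c.dTVMaxC_le (by linarith : δ < 1) h6 h3 ht0
  have h10 : δ / (1 - δ) ≤ 2 * δ := by
    rw [div_le_iff₀ (by linarith)]
    nlinarith
  linarith

lemma le_dTVMaxC_of_le (hl : IsSmallestNonzeroEig (1 - c.K) l) (hδ : 0 < δ) (hδ1 : δ ≤ 1 / 2)
    (h₁ : δ ≤ c.piLow M) (h₂ : δ ≤ c.piHigh M) (ht0 : 0 ≤ t)
    (ht : t ≤ c.endMean M - 3 * (c.endDev M / δ ^ 2)) : 1 - 2 * δ ≤ c.dTVMaxC t := by
  obtain ⟨M₂, h3, h4⟩ := c.exists_quantile hδ.le (by linarith : δ ≤ 1)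
  obtain ⟨M₁, h5, h6⟩ := c.exists_quantile (by linarith : 0 ≤ 1 - δ) (by linarith)
  rw [sub_sub_cancel] at h5
  have hα := endDev_pos (M := M) hl
  have hlα := one_le_gap_mul_endDev (M := M) hl
  have hsq := c.endDev_sq M
  rw [endMean_eq] at ht
  rcases max_choice (c.climbMean M) (c.rev.climbMean M.rev) with h | h
  · rw [h] at ht
    have := one_sub_hitSurvC_zero_le_of_le hl hδ (by linarith) hα hlα (hsq ▸ le_max_left _ _)
      h₁ h₂ h5 (by linarith) ht0 ht
    linarith [c.hitSurvC_zero_le_dTVMaxC M₁ ht0]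
  · rw [h] at ht
    have := one_sub_hitSurvC_zero_le_of_le (c.rev_gap hl) hδ (by linarith) hα hlα
      (hsq ▸ le_max_right _ _) (by rwa [rev_piLow]) (by rwa [rev_piHigh]) (b := M₂.rev)
      (by rwa [rev_piLow]) (by rw [rev_piHigh]; linarith) ht0 ht
    rw [rev_hitSurvC, Fin.rev_rev, Fin.rev_zero] at this
    linarith [c.hitSurvC_last_le_dTVMaxC M₂ ht0]

/-- The mixing time is within a constant number of standard deviations of the larger of the mean
hitting times of a central state from the two ends. -/
lemma exists_abs_mixC_sub_le {ε : ℝ} (hδ : 0 < δ) (hε : ε ∈ Set.Ioo (0 : ℝ) 1) :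
    ∃ C, 0 ≤ C ∧ ∀ (n : ℕ) (c : BDChain n) (l : ℝ) (M : Fin (n + 1)),
      IsSmallestNonzeroEig (1 - c.K) l → δ ≤ c.piLow M → δ ≤ c.piHigh M →
        |mixC c.dTVMaxC ε - c.endMean M| ≤ C * c.endDev M := by
  obtain ⟨hε0, hε1⟩ := hε
  set d := min δ (min (ε / 6) ((1 - ε) / 6)) with hd
  have hd0 : 0 < d := lt_min hδ (lt_min (by linarith) (by linarith))
  have hd1 : d ≤ δ := min_le_left _ _
  have hd2 : d ≤ ε / 6 := (min_le_right _ _).trans (min_le_left _ _)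
  have hd3 : d ≤ (1 - ε) / 6 := (min_le_right _ _).trans (min_le_right _ _)
  refine ⟨3 / d ^ 2, by positivity, fun n c l M hl h₁ h₂ => ?_⟩
  have hq : 3 / d ^ 2 * c.endDev M = 3 * (c.endDev M / d ^ 2) := by ring
  have hα := endDev_pos (M := M) hl
  have hθ : 0 ≤ c.endMean M := by
    rw [endMean_eq]; exact le_max_of_le_left (c.climbMean_nonneg M)
  have hmem : c.endMean M + 3 * (c.endDev M / d ^ 2) ∈ {t : ℝ | 0 ≤ t ∧ c.dTVMaxC t ≤ ε} :=
    ⟨by positivity, (dTVMaxC_le_of_ge hl hd0 (by linarith) (hd1.trans h₁) (hd1.trans h₂)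
      le_rfl).trans (by linarith)⟩
  rw [hq, abs_le]
  constructor
  · have : c.endMean M - 3 * (c.endDev M / d ^ 2) ≤ mixC c.dTVMaxC ε := by
      refine le_csInf ⟨_, hmem⟩ fun t ht => ?_
      by_contra! h
      have := le_dTVMaxC_of_le hl hd0 (by linarith) (hd1.trans h₁) (hd1.trans h₂) ht.1 h.le
      linarith [ht.2]
    linarith
  · have : mixC c.dTVMaxC ε ≤ c.endMean M + 3 * (c.endDev M / d ^ 2) :=
      csInf_le ⟨0, fun t ht => ht.1⟩ hmem
    linarith

/-- Relaxation is a lower bound for mixing. -/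
lemma log_le_gap_mul_mixC (hl : IsSmallestNonzeroEig (1 - c.K) l) {ε : ℝ}
    (hε : ε ∈ Set.Ioo (0 : ℝ) 1) : Real.log (1 / (2 * ε)) ≤ l * mixC c.dTVMaxC ε := by
  have hl0 := gap_pos hl
  obtain ⟨hε0, hε1⟩ := hε
  obtain ⟨M, h₁, h₂⟩ := c.exists_quantile (δ := 1 / 2) (by norm_num) (by norm_num)
  have hd0 : 0 < ε / 6 := by linarith
  rw [← div_le_iff₀' hl0]
  refine le_csInf ⟨_, ?_, (dTVMaxC_le_of_ge hl hd0 (by linarith) (by linarith : ε / 6 ≤ c.piLow M)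
    (by linarith) le_rfl).trans (by linarith)⟩ fun t ht => ?_
  · have hα := endDev_pos (M := M) hl
    have hθ : 0 ≤ c.endMean M := by
      rw [endMean_eq]; exact le_max_of_le_left (c.climbMean_nonneg M)
    positivity
  · rw [div_le_iff₀' hl0, Real.log_le_iff_le_exp (by positivity)]
    have h := (c.exp_le_dTVMaxC hl t).trans ht.2
    rw [div_le_iff₀ (by positivity)]
    have h2 : Real.exp (l * t) * Real.exp (-(l * t)) = 1 := by
      rw [← Real.exp_add, add_neg_cancel, Real.exp_zero]
    nlinarith [Real.exp_pos (l * t)]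

end BDChain

section Asymptotics

variable {T : ℝ → ℕ → ℝ} {lam θ α : ℕ → ℝ}

lemma tendsto_mul_gap_of_hasCutoff {C δ : ℝ} (hC : 0 ≤ C) (hδ : 0 < δ)
    (hlam : ∀ᶠ n in atTop, 0 < lam n)
    (hT : ∀ᶠ n in atTop, |T (1 / 2) n - θ n| ≤ C * α n)
    (hlog : ∀ ε ∈ Set.Ioo (0 : ℝ) 1, ∀ᶠ n in atTop, Real.log (1 / (2 * ε)) ≤ lam n * T ε n)
    (hsq : ∀ᶠ n in atTop, lam n * δ * α n ^ 2 ≤ 2 * θ n) (h : hasCutoff T) :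
    Tendsto (fun n => θ n * lam n) atTop atTop := by
  obtain ⟨t, ht0, ht⟩ := h
  have ht1 : Tendsto (fun n => t n * lam n) atTop atTop := by
    refine tendsto_atTop.2 fun A => ?_
    set ε := Real.exp (-(2 * max A 0)) / 2 with hε
    have hmem : ε ∈ Set.Ioo (0 : ℝ) 1 := by
      have := Real.exp_pos (-(2 * max A 0))
      have h2 : Real.exp (-(2 * max A 0)) ≤ 1 :=
        Real.exp_le_one_iff.2 (by linarith [le_max_right A 0])
      exact ⟨by positivity, by linarith⟩
    have hlogε : Real.log (1 / (2 * ε)) = 2 * max A 0 := by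
      rw [hε, mul_div_cancel₀ _ two_ne_zero, one_div, Real.log_inv, Real.log_exp, neg_neg]
    filter_upwards [hlog ε hmem, (ht ε hmem).eventually_le_const one_lt_two, hlam] with n h1 h2 h3
    rw [hlogε] at h1
    rw [div_le_iff₀ (ht0 n)] at h2
    have := mul_le_mul_of_nonneg_left h2 h3.le
    linarith [le_max_left A 0]
  refine tendsto_atTop.2 fun A => ?_
  have hpos : 0 < 1 + 2 * C / δ := by positivity
  filter_upwards [ht1.eventually_ge_atTop (2 * (A * (1 + 2 * C / δ) + C)), hT, hsq, hlam,
    (ht (1 / 2) ⟨by norm_num, by norm_num⟩).eventually_const_le (by norm_num : (1 / 2 : ℝ) < 1)]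
    with n h1 h2 h3 h4 h5
  rw [le_div_iff₀ (ht0 n)] at h5
  have h6 := mul_le_mul_of_nonneg_right (h5.trans (sub_le_iff_le_add.1 (le_of_abs_le h2))) h4.le
  have h7 : α n * lam n ≤ 1 + 2 * (θ n * lam n) / δ := by
    have h8 : (α n * lam n) ^ 2 ≤ 2 * (θ n * lam n) / δ := by
      rw [le_div_iff₀ hδ]
      have := mul_le_mul_of_nonneg_right h3 h4.le
      linarith
    nlinarith [sq_nonneg (α n * lam n - 1)]
  have h9 := mul_le_mul_of_nonneg_left h7 hC
  have h10 : C * (1 + 2 * (θ n * lam n) / δ) = C + (θ n * lam n) * (2 * C / δ) := by ring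
  refine le_of_mul_le_mul_right ?_ hpos
  linarith

lemma tendsto_div_of_tendsto_mul_gap {δ : ℝ} (hδ : 0 < δ) (hα : ∀ᶠ n in atTop, 0 < α n)
    (hθ : ∀ᶠ n in atTop, 0 ≤ θ n) (hsq : ∀ᶠ n in atTop, lam n * δ * α n ^ 2 ≤ 2 * θ n)
    (h : Tendsto (fun n => θ n * lam n) atTop atTop) :
    Tendsto (fun n => θ n / α n) atTop atTop := by
  refine tendsto_atTop.2 fun A => ?_
  filter_upwards [h.eventually_ge_atTop (2 * A ^ 2 / δ), hα, hθ, hsq] with n h1 h2 h3 h4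
  rw [div_le_iff₀ hδ] at h1
  rw [le_div_iff₀ h2]
  refine le_of_sq_le_sq ?_ h3
  have h5 := mul_le_mul_of_nonneg_left h4 h3
  have h6 := mul_le_mul_of_nonneg_right h1 (sq_nonneg (α n))
  nlinarith

lemma tendsto_mul_gap_of_tendsto_div (hα : ∀ᶠ n in atTop, 0 < α n)
    (hθ : ∀ᶠ n in atTop, 0 ≤ θ n) (hlα : ∀ᶠ n in atTop, 1 ≤ lam n * α n)
    (h : Tendsto (fun n => θ n / α n) atTop atTop) :
    Tendsto (fun n => θ n * lam n) atTop atTop := by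
  refine tendsto_atTop_mono' _ ?_ h
  filter_upwards [hα, hθ, hlα] with n h1 h2 h3
  rw [div_le_iff₀ h1, mul_assoc]
  exact le_mul_of_one_le_right h2 h3

lemma cutoffWindow_of_tendsto_div (hα : ∀ᶠ n in atTop, 0 < α n)
    (hT : ∀ ε ∈ Set.Ioo (0 : ℝ) 1, ∃ C : ℝ, ∀ᶠ n in atTop, |T ε n - θ n| ≤ C * α n)
    (h : Tendsto (fun n => θ n / α n) atTop atTop) : cutoffWindow T θ α := by
  refine ⟨?_, hα, ?_, hT⟩
  · filter_upwards [hα, h.eventually_gt_atTop 0] with n h1 h2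
    exact (div_pos_iff_of_pos_right h1).1 h2
  · simpa only [Function.comp_def, inv_div] using tendsto_inv_atTop_zero.comp h

lemma hasCutoff_of_cutoffWindow {t b : ℕ → ℝ} (h : cutoffWindow T t b) : hasCutoff T := by
  obtain ⟨h1, h2, h3, h4⟩ := h
  refine ⟨fun n => if 0 < t n then t n else 1, fun n => ?_, fun ε hε => ?_⟩
  · dsimp only
    split_ifs with h
    · exact h
    · exact one_pos
  · obtain ⟨C, hC⟩ := h4 ε hε
    rw [tendsto_iff_norm_sub_tendsto_zero]
    have h5 : Tendsto (fun n => C * (b n / t n)) atTop (nhds 0) := by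
      simpa using h3.const_mul C
    refine squeeze_zero' (Eventually.of_forall fun n => norm_nonneg _) ?_ h5
    filter_upwards [h1, hC] with n h6 h7
    rw [if_pos h6, Real.norm_eq_abs, div_sub_one h6.ne', abs_div, abs_of_pos h6, ← mul_div_assoc]
    exact div_le_div_of_nonneg_right h7 h6.le

end Asymptotics

/-- Theorem `t-tv2`(1).  With `θ_n = max{E_0 τ̃_{M_n}, E_n τ̃_{M_n}}` and
`α_n² = max{Var_0 τ̃_{M_n}, Var_n τ̃_{M_n}}`, the continuous-time family `F_c` has a maximum
total variation cutoff iff `θ_n λ_n → ∞` iff `θ_n / α_n → ∞`, in which case it has a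
`(θ_n, α_n)` cutoff. -/
theorem birth_death_continuous_maxTV_cutoff
    (F : (n : ℕ) → BDChain n) (lam : ℕ → ℝ)
    (hlam : ∀ n, 0 < n → IsSmallestNonzeroEig (1 - (F n).K) (lam n))
    (M : (n : ℕ) → Fin (n + 1))
    (hMlow : ∃ c > 0, ∀ n, c ≤ (F n).piLow (M n))
    (hMhigh : ∃ c > 0, ∀ n, c ≤ (F n).piHigh (M n))
    (θ α : ℕ → ℝ)
    (hθ : ∀ n, θ n = max ((F n).hitMeanC (M n) 0) ((F n).hitMeanC (M n) (Fin.last n)))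
    (hα : ∀ n, α n =
      Real.sqrt (max ((F n).hitVarC (M n) 0) ((F n).hitVarC (M n) (Fin.last n)))) :
    (hasCutoff (fun ε n => mixC ((F n).dTVMaxC) ε) ↔
      Filter.Tendsto (fun n => θ n * lam n) Filter.atTop Filter.atTop) ∧
    (hasCutoff (fun ε n => mixC ((F n).dTVMaxC) ε) ↔
      Filter.Tendsto (fun n => θ n / α n) Filter.atTop Filter.atTop) ∧
    (hasCutoff (fun ε n => mixC ((F n).dTVMaxC) ε) →
      cutoffWindow (fun ε n => mixC ((F n).dTVMaxC) ε) θ α) := by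
  obtain ⟨δ₁, hδ₁, hlow⟩ := hMlow
  obtain ⟨δ₂, hδ₂, hhigh⟩ := hMhigh
  set δ := min δ₁ δ₂
  have hδ : 0 < δ := lt_min hδ₁ hδ₂
  have h₁ : ∀ n, δ ≤ (F n).piLow (M n) := fun n => (min_le_left _ _).trans (hlow n)
  have h₂ : ∀ n, δ ≤ (F n).piHigh (M n) := fun n => (min_le_right _ _).trans (hhigh n)
  obtain rfl : θ = fun n => (F n).endMean (M n) := funext hθ
  obtain rfl : α = fun n => (F n).endDev (M n) := funext hα
  have hgap : ∀ᶠ n in atTop, 0 < n := eventually_gt_atTop 0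
  have hpos : ∀ᶠ n in atTop, 0 < lam n := hgap.mono fun n hn => BDChain.gap_pos (hlam n hn)
  have hdev : ∀ᶠ n in atTop, 0 < (F n).endDev (M n) :=
    hgap.mono fun n hn => BDChain.endDev_pos (hlam n hn)
  have hmean : ∀ᶠ n in atTop, 0 ≤ (F n).endMean (M n) := Eventually.of_forall fun n => by
    rw [BDChain.endMean_eq]; exact le_max_of_le_left ((F n).climbMean_nonneg _)
  have hsq : ∀ᶠ n in atTop, lam n * δ * (F n).endDev (M n) ^ 2 ≤ 2 * (F n).endMean (M n) :=
    hgap.mono fun n hn => BDChain.gap_mul_endDev_sq_le (hlam n hn) hδ (h₁ n) (h₂ n)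
  have hmix : ∀ ε ∈ Set.Ioo (0 : ℝ) 1, ∃ C : ℝ, 0 ≤ C ∧ ∀ᶠ n in atTop,
      |mixC (F n).dTVMaxC ε - (F n).endMean (M n)| ≤ C * (F n).endDev (M n) := fun ε hε => by
    obtain ⟨C, hC, h⟩ := BDChain.exists_abs_mixC_sub_le hδ hε
    exact ⟨C, hC, hgap.mono fun n hn => h n (F n) (lam n) (M n) (hlam n hn) (h₁ n) (h₂ n)⟩
  obtain ⟨C, hC, hhalf⟩ := hmix (1 / 2) ⟨by norm_num, by norm_num⟩
  have hto : hasCutoff (fun ε n => mixC ((F n).dTVMaxC) ε) →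
      Tendsto (fun n => (F n).endMean (M n) * lam n) atTop atTop :=
    tendsto_mul_gap_of_hasCutoff hC hδ hpos hhalf
      (fun ε hε => hgap.mono fun n hn => BDChain.log_le_gap_mul_mixC (hlam n hn) hε) hsq
  have hdiv := tendsto_div_of_tendsto_mul_gap hδ hdev hmean hsq
  have hmul := tendsto_mul_gap_of_tendsto_div (lam := lam) hdev hmean
    (hgap.mono fun n hn => BDChain.one_le_gap_mul_endDev (hlam n hn))
  have hwin := cutoffWindow_of_tendsto_div (T := fun ε n => mixC ((F n).dTVMaxC) ε) hdev
    fun ε hε => (hmix ε hε).imp fun C h => h.2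
  exact ⟨⟨hto, fun h => hasCutoff_of_cutoffWindow (hwin (hdiv h))⟩,
    ⟨fun h => hdiv (hto h), fun h => hasCutoff_of_cutoffWindow (hwin h)⟩,
    fun h => hwin (hdiv (hto h))⟩

end
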